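/- Let H, f₁, …, f_n be finitely many multipliers of the Dirichlet space 𝒟 such that |H(z)| ≤ (∑_{j=1}^n |f_j(z)|²)^{1/2} for all z in the open unit disk 𝔻. Then H³ belongs to the ideal generated by f₁, …, f_n in ℳ(𝒟); that is, there exist multipliers g₁, …, g_n of 𝒟 with H(z)³ = ∑_{j=1}^n f_j(z) g_j(z) for all z ∈ 𝔻. -/

import Mathlib

open Metric MeasureTheory Complex

/-- Taylor coefficient at 0. -/
noncomputable def dirCoeff (f : ℂ → ℂ) (n : ℕ) : ℂ :=
  iteratedDeriv n f 0 / (n.factorial : ℂ)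

/-- Membership in the Dirichlet space. -/
def MemDirichlet (f : ℂ → ℂ) : Prop :=
  DifferentiableOn ℂ f (ball (0:ℂ) 1) ∧
  Summable (fun n : ℕ => ((n : ℝ) + 1) * ‖dirCoeff f n‖ ^ 2)

/-- Squared Dirichlet norm. -/
noncomputable def dirNormSq (f : ℂ → ℂ) : ℝ :=
  ∑' n : ℕ, ((n : ℝ) + 1) * ‖dirCoeff f n‖ ^ 2

/-- Multiplier of the Dirichlet space. -/
def IsMultiplier (φ : ℂ → ℂ) : Prop :=
  DifferentiableOn ℂ φ (ball (0:ℂ) 1) ∧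
  ∀ f, MemDirichlet f → MemDirichlet (fun z => φ z * f z)

/-- Operator norm of the multiplication operator. -/
noncomputable def multNorm (φ : ℂ → ℂ) : ℝ :=
  sInf {C : ℝ | 0 ≤ C ∧ ∀ f, MemDirichlet f →
    dirNormSq (fun z => φ z * f z) ≤ C ^ 2 * dirNormSq f}

/-- The column operator of `F` has norm at most `C`. -/
def ColNormLE (F : ℕ → ℂ → ℂ) (C : ℝ) : Prop :=
  ∀ h, MemDirichlet h →
    Summable (fun j : ℕ => dirNormSq (fun z => F j z * h z)) ∧
    (∑' j : ℕ, dirNormSq (fun z => F j z * h z)) ≤ C ^ 2 * dirNormSq h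

namespace DirichletWolff

open scoped Polynomial PowerSeries ENNReal
open PowerSeries (coeff)

/-- The bilinear coefficient pairing of a power series with a polynomial. -/
noncomputable def pair (g : ℂ⟦X⟧) : ℂ[X] →ₗ[ℂ] ℂ :=
  Polynomial.lsum fun i => (coeff i g) • LinearMap.id

/-- The transpose, with respect to `pair`, of multiplication by `φ`. -/
noncomputable def transMul (φ : ℂ⟦X⟧) : ℂ[X] →ₗ[ℂ] ℂ[X] :=
  Polynomial.lsum fun i =>
    ∑ j ∈ Finset.range (i + 1), (coeff j φ) • Polynomial.monomial (i - j)

theorem pair_monomial (g : ℂ⟦X⟧) (i : ℕ) (c : ℂ) :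
    pair g (Polynomial.monomial i c) = coeff i g * c := by
  simp [pair, Polynomial.lsum_apply, Polynomial.sum_monomial_index]

theorem transMul_monomial (φ : ℂ⟦X⟧) (i : ℕ) (c : ℂ) :
    transMul φ (Polynomial.monomial i c) =
      ∑ j ∈ Finset.range (i + 1), Polynomial.monomial (i - j) (coeff j φ * c) := by
  simp [transMul, Polynomial.lsum_apply, Polynomial.sum_monomial_index, Polynomial.smul_monomial]

theorem pair_eq_sum (g : ℂ⟦X⟧) (q : ℂ[X]) {s : Finset ℕ} (hs : q.support ⊆ s) :
    pair g q = ∑ i ∈ s, coeff i g * q.coeff i := by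
  rw [pair, Polynomial.lsum_apply, Polynomial.sum_def]
  simpa using Finset.sum_subset hs (fun i _ hi => by simp [Polynomial.notMem_support_iff.1 hi])

theorem pair_transMul (g φ : ℂ⟦X⟧) (q : ℂ[X]) :
    pair g (transMul φ q) = pair (φ * g) q := by
  induction q using Polynomial.induction_on' with
  | add p q hp hq => simp [hp, hq]
  | monomial i c =>
    rw [transMul_monomial, map_sum, pair_monomial, PowerSeries.coeff_mul, Finset.sum_mul,
      Finset.Nat.sum_antidiagonal_eq_sum_range_succ_mk]
    refine Finset.sum_congr rfl fun j _ => ?_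
    rw [pair_monomial]; ring

theorem pair_X_pow (i : ℕ) (q : ℂ[X]) : pair (PowerSeries.X ^ i) q = q.coeff i := by
  induction q using Polynomial.induction_on' with
  | add p q hp hq => simp [hp, hq]
  | monomial j c =>
    rw [pair_monomial, PowerSeries.coeff_X_pow, Polynomial.coeff_monomial]
    split_ifs <;> simp_all

theorem coeff_transMul (φ : ℂ⟦X⟧) (q : ℂ[X]) (m : ℕ) :
    (transMul φ q).coeff m = pair (φ * PowerSeries.X ^ m) q := by
  rw [← pair_X_pow, pair_transMul]

theorem transMul_mul (φ ψ : ℂ⟦X⟧) (q : ℂ[X]) :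
    transMul (φ * ψ) q = transMul φ (transMul ψ q) := by
  ext m
  rw [coeff_transMul, coeff_transMul, pair_transMul]
  congr 2; ring

theorem transMul_comm (φ ψ : ℂ⟦X⟧) (q : ℂ[X]) :
    transMul φ (transMul ψ q) = transMul ψ (transMul φ q) := by
  rw [← transMul_mul, ← transMul_mul, mul_comm]

theorem pair_smul (c : ℂ) (g : ℂ⟦X⟧) (q : ℂ[X]) : pair (c • g) q = c * pair g q := by
  rw [pair_eq_sum _ _ subset_rfl, pair_eq_sum _ _ subset_rfl, Finset.mul_sum]
  simp [mul_assoc]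

theorem transMul_one (q : ℂ[X]) : transMul 1 q = q := by
  ext m; rw [coeff_transMul, one_mul, pair_X_pow]

theorem transMul_smul (c : ℂ) (φ : ℂ⟦X⟧) (q : ℂ[X]) : transMul (c • φ) q = c • transMul φ q := by
  ext m
  rw [coeff_transMul, smul_mul_assoc, pair_smul, Polynomial.coeff_smul, coeff_transMul, smul_eq_mul]

theorem coeff_transMul_X_pow (n : ℕ) (q : ℂ[X]) (m : ℕ) :
    (transMul (PowerSeries.X ^ n) q).coeff m = q.coeff (n + m) := by
  rw [coeff_transMul, ← pow_add, pair_X_pow]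

theorem coeff_transMul_eq_sum (φ : ℂ⟦X⟧) (q : ℂ[X]) (m : ℕ) {N : ℕ} (hN : q.natDegree < N) :
    (transMul φ q).coeff m = ∑ j ∈ Finset.range N, coeff j φ * q.coeff (j + m) := by
  have h : (transMul φ q).coeff m = pair φ (transMul (PowerSeries.X ^ m) q) := by
    rw [coeff_transMul, pair_transMul, mul_comm]
  rw [h, pair_eq_sum (s := Finset.range N)]
  · exact Finset.sum_congr rfl fun j _ => by rw [coeff_transMul_X_pow, add_comm]
  · intro i hi
    rw [Polynomial.mem_support_iff, coeff_transMul_X_pow] at hi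
    have := Polynomial.le_natDegree_of_ne_zero hi
    simp; omega

/-- Squared norm of a polynomial in the Dirichlet space. -/
noncomputable def dirSq (g : ℂ[X]) : ℝ := ∑ i ∈ g.support, ((i : ℝ) + 1) * ‖g.coeff i‖ ^ 2

/-- Squared norm of a polynomial in the dual of the Dirichlet space under `pair`. -/
noncomputable def dualSq (q : ℂ[X]) : ℝ := ∑ i ∈ q.support, ‖q.coeff i‖ ^ 2 / ((i : ℝ) + 1)

theorem dirSq_eq_sum (g : ℂ[X]) {s : Finset ℕ} (hs : g.support ⊆ s) :
    dirSq g = ∑ i ∈ s, ((i : ℝ) + 1) * ‖g.coeff i‖ ^ 2 :=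
  Finset.sum_subset hs fun i _ hi => by simp [Polynomial.notMem_support_iff.1 hi]

theorem dualSq_eq_sum (g : ℂ[X]) {s : Finset ℕ} (hs : g.support ⊆ s) :
    dualSq g = ∑ i ∈ s, ‖g.coeff i‖ ^ 2 / ((i : ℝ) + 1) :=
  Finset.sum_subset hs fun i _ hi => by simp [Polynomial.notMem_support_iff.1 hi]

theorem support_subset_range {q : ℂ[X]} {N : ℕ} (hN : q.natDegree < N) :
    q.support ⊆ Finset.range N := fun i hi => by
  have := Polynomial.le_natDegree_of_mem_supp i hi
  simp; omega

theorem dualSq_nonneg (g : ℂ[X]) : 0 ≤ dualSq g := Finset.sum_nonneg fun _ _ => by positivity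

theorem dualSq_smul (c : ℂ) (q : ℂ[X]) : dualSq (c • q) = ‖c‖ ^ 2 * dualSq q := by
  rw [dualSq_eq_sum (c • q) (Polynomial.support_smul c q), dualSq, Finset.mul_sum]
  refine Finset.sum_congr rfl fun i _ => ?_
  rw [Polynomial.coeff_smul, norm_smul, mul_pow, mul_div_assoc]

theorem norm_pair_le (g : ℂ⟦X⟧) (q : ℂ[X]) {N : ℕ} (hN : q.natDegree < N) :
    ‖pair g q‖ ≤ √(∑ i ∈ Finset.range N, ((i : ℝ) + 1) * ‖coeff i g‖ ^ 2) * √(dualSq q) := by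
  rw [pair_eq_sum g q (support_subset_range hN), dualSq_eq_sum q (support_subset_range hN)]
  refine (norm_sum_le _ _).trans ?_
  have := Real.sum_mul_le_sqrt_mul_sqrt (Finset.range N)
    (fun i => √((i : ℝ) + 1) * ‖coeff i g‖) (fun i => ‖q.coeff i‖ / √((i : ℝ) + 1))
  have hpos : ∀ i : ℕ, √((i : ℝ) + 1) ≠ 0 := fun i => by positivity
  have hsq : ∀ i : ℕ, √((i : ℝ) + 1) ^ 2 = (i : ℝ) + 1 := fun i => Real.sq_sqrt (by positivity)
  simp only [mul_pow, div_pow, hsq] at this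
  refine le_trans (le_of_eq (Finset.sum_congr rfl fun i _ => ?_)) this
  have := hpos i
  rw [norm_mul]
  field_simp

theorem norm_pair_coe_le (g q : ℂ[X]) :
    ‖pair g q‖ ≤ √(dirSq g) * √(dualSq q) := by
  refine (norm_pair_le g q (N := max g.natDegree q.natDegree + 1) (by omega)).trans_eq ?_
  rw [dirSq_eq_sum g (support_subset_range (N := max g.natDegree q.natDegree + 1) (by omega))]
  simp

/-- `φ` multiplies the Dirichlet space with norm at most `M`, expressed on the dual side. -/
def MultBound (φ : ℂ⟦X⟧) (M : ℝ) : Prop :=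
  ∀ q, dualSq (transMul φ q) ≤ M ^ 2 * dualSq q

/-- The polynomial norming the first `N` coefficients of `g` in the Dirichlet norm. -/
noncomputable def normer (g : ℂ⟦X⟧) (N : ℕ) : ℂ[X] :=
  ∑ i ∈ Finset.range N, Polynomial.monomial i (((i : ℂ) + 1) * (starRingEnd ℂ) (coeff i g))

theorem coeff_normer (g : ℂ⟦X⟧) (N i : ℕ) :
    (normer g N).coeff i = if i < N then ((i : ℂ) + 1) * (starRingEnd ℂ) (coeff i g) else 0 := by
  simp [normer, Polynomial.finsetSum_coeff, Polynomial.coeff_monomial]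

theorem support_normer (g : ℂ⟦X⟧) (N : ℕ) : (normer g N).support ⊆ Finset.range N := fun i hi => by
  rw [Polynomial.mem_support_iff, coeff_normer] at hi
  simp only [Finset.mem_range]
  by_contra h
  simp [h] at hi

theorem norm_natCast_add_one (i : ℕ) : ‖(i : ℂ) + 1‖ = (i : ℝ) + 1 := by
  rw [← Nat.cast_succ, Complex.norm_natCast]; simp

theorem pair_normer (g : ℂ⟦X⟧) (N : ℕ) :
    pair g (normer g N) = (∑ i ∈ Finset.range N, ((i : ℝ) + 1) * ‖coeff i g‖ ^ 2 : ℝ) := by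
  rw [pair_eq_sum _ _ (support_normer g N)]
  push_cast
  refine Finset.sum_congr rfl fun i hi => ?_
  rw [coeff_normer, if_pos (Finset.mem_range.1 hi), ← Complex.mul_conj']
  ring

theorem dualSq_normer (g : ℂ⟦X⟧) (N : ℕ) :
    dualSq (normer g N) = ∑ i ∈ Finset.range N, ((i : ℝ) + 1) * ‖coeff i g‖ ^ 2 := by
  rw [dualSq_eq_sum _ (support_normer g N)]
  refine Finset.sum_congr rfl fun i hi => ?_
  rw [coeff_normer, if_pos (Finset.mem_range.1 hi), norm_mul, norm_natCast_add_one,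
    RCLike.norm_conj]
  have : (i : ℝ) + 1 ≠ 0 := by positivity
  field_simp

theorem natDegree_transMul_le (φ : ℂ⟦X⟧) (q : ℂ[X]) :
    (transMul φ q).natDegree ≤ q.natDegree := by
  rw [Polynomial.natDegree_le_iff_coeff_eq_zero]
  intro m hm
  rw [coeff_transMul_eq_sum φ q m (Nat.lt_succ_self _)]
  refine Finset.sum_eq_zero fun j _ => ?_
  rw [Polynomial.coeff_eq_zero_of_natDegree_lt (by omega), mul_zero]

theorem natDegree_normer_lt (g : ℂ⟦X⟧) (N : ℕ) : (normer g N).natDegree < N + 1 := by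
  have : (normer g N).natDegree ≤ N := by
    rw [Polynomial.natDegree_le_iff_coeff_eq_zero]
    intro m hm
    rw [coeff_normer, if_neg (by omega)]
  omega

theorem MultBound.sum_mul_le {φ : ℂ⟦X⟧} {M : ℝ} (hφ : MultBound φ M) (g : ℂ⟦X⟧) (N : ℕ) :
    ∑ i ∈ Finset.range N, ((i : ℝ) + 1) * ‖coeff i (φ * g)‖ ^ 2 ≤
      M ^ 2 * ∑ i ∈ Finset.range (N + 1), ((i : ℝ) + 1) * ‖coeff i g‖ ^ 2 := by
  set A := ∑ i ∈ Finset.range N, ((i : ℝ) + 1) * ‖coeff i (φ * g)‖ ^ 2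
  set B := ∑ i ∈ Finset.range (N + 1), ((i : ℝ) + 1) * ‖coeff i g‖ ^ 2
  have hA : 0 ≤ A := Finset.sum_nonneg fun _ _ => by positivity
  have hB : 0 ≤ B := Finset.sum_nonneg fun _ _ => by positivity
  set q := normer (φ * g) N
  have h1 : ‖pair g (transMul φ q)‖ = A := by
    rw [pair_transMul, pair_normer, Complex.norm_real, Real.norm_of_nonneg hA]
  have h2 := norm_pair_le g (transMul φ q)
    ((natDegree_transMul_le φ q).trans_lt (natDegree_normer_lt _ N))
  rw [h1] at h2
  have h3 : dualSq (transMul φ q) ≤ M ^ 2 * A := by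
    simpa [q, dualSq_normer] using hφ q
  have h4 : A ^ 2 ≤ B * (M ^ 2 * A) := by
    calc A ^ 2 ≤ (√B * √(dualSq (transMul φ q))) ^ 2 := by gcongr
      _ = B * dualSq (transMul φ q) := by
        rw [mul_pow, Real.sq_sqrt hB, Real.sq_sqrt (dualSq_nonneg _)]
      _ ≤ _ := by gcongr
  rcases hA.eq_or_lt with h | h
  · rw [← h]; positivity
  · nlinarith

theorem MultBound.dirSq_mul_le {f : ℂ[X]} {M : ℝ} (hf : MultBound f M) (g : ℂ[X]) :
    dirSq (f * g) ≤ M ^ 2 * dirSq g := by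
  set N := max (f * g).natDegree g.natDegree + 1
  have := hf.sum_mul_le g N
  rw [dirSq_eq_sum (f * g) (support_subset_range (N := N) (by omega)),
    dirSq_eq_sum g (support_subset_range (N := N + 1) (by omega))]
  simpa [← Polynomial.coe_mul] using this

section

/-- The coefficients `c` with `1 - ∑ c m * t ^ (m + 1)` the reciprocal of `∑ t ^ i / (i + 1)`. -/
noncomputable def recipCoeff : ℕ → ℝ
  | n => 1 / ((n : ℝ) + 2) - ∑ m : Fin n, recipCoeff m * (1 / (((n - m : ℕ) : ℝ) + 1))

theorem recipCoeff_eq (n : ℕ) :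
    recipCoeff n =
      1 / ((n : ℝ) + 2) - ∑ m ∈ Finset.range n, recipCoeff m * (1 / (((n - m : ℕ) : ℝ) + 1)) := by
  rw [recipCoeff, Finset.sum_range]

theorem sum_recipCoeff (n : ℕ) :
    ∑ m ∈ Finset.range (n + 1), recipCoeff m * (1 / (((n - m : ℕ) : ℝ) + 1)) =
      1 / ((n : ℝ) + 2) := by
  rw [Finset.sum_range_succ, recipCoeff_eq n]
  simp

theorem recipCoeff_nonneg (n : ℕ) : 0 ≤ recipCoeff n := by
  induction n using Nat.strong_induction_on with
  | _ n ih =>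
    rw [recipCoeff_eq, sub_nonneg]
    rcases n with _ | n
    · simp
    have h := sum_recipCoeff n
    have : ∑ m ∈ Finset.range (n + 1), recipCoeff m * (1 / (((n + 1 - m : ℕ) : ℝ) + 1)) ≤
        ∑ m ∈ Finset.range (n + 1), recipCoeff m * (1 / (((n - m : ℕ) : ℝ) + 1)) *
          (((n : ℝ) + 2) / (n + 3)) := by
      refine Finset.sum_le_sum fun m hm => ?_
      have hm' : m ≤ n := by simpa [Nat.lt_succ_iff] using hm
      rw [mul_assoc]
      refine mul_le_mul_of_nonneg_left ?_ (ih m (by omega))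
      have h1 : m ≤ n + 1 := by omega
      rw [Nat.cast_sub hm', Nat.cast_sub h1]
      have : (m : ℝ) ≤ n := by exact_mod_cast hm'
      have h0 : (0 : ℝ) ≤ m := m.cast_nonneg
      push_cast
      rw [div_mul_div_comm, div_le_div_iff₀ (by linarith) (by nlinarith)]
      nlinarith
    refine this.trans ?_
    rw [← Finset.sum_mul, h]
    push_cast
    apply le_of_eq
    have : (n : ℝ) + 2 ≠ 0 := by positivity
    field_simp
    ring

theorem sum_recipCoeff_shift (N : ℕ) (a : ℕ → ℝ) (ha : ∀ i, N ≤ i → a i = 0) :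
    ∑ j ∈ Finset.range N, 1 / ((j : ℝ) + 1) *
        ∑ m ∈ Finset.range N, recipCoeff m * a (j + m + 1) =
      ∑ i ∈ Finset.range N, 1 / ((i : ℝ) + 1) * a i - a 0 := by
  have h1 : ∀ j ∈ Finset.range N, 1 / ((j : ℝ) + 1) *
      ∑ m ∈ Finset.range N, recipCoeff m * a (j + m + 1) =
      ∑ m ∈ Finset.range (N - j), 1 / ((j : ℝ) + 1) * (recipCoeff m * a (j + m + 1)) := by
    intro j _
    rw [← Finset.mul_sum]
    congr 1
    symm
    refine Finset.sum_subset (fun m hm => ?_) (fun m _ hm => ?_)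
    · simp at hm ⊢; omega
    · rw [ha, mul_zero]; simp at hm; omega
  rw [Finset.sum_congr rfl h1,
    ← Finset.sum_range_diag_flip N fun j m => 1 / ((j : ℝ) + 1) * (recipCoeff m * a (j + m + 1))]
  have h2 : ∀ i ∈ Finset.range N, ∑ j ∈ Finset.range (i + 1),
      1 / ((j : ℝ) + 1) * (recipCoeff (i - j) * a (j + (i - j) + 1)) =
      1 / (((i + 1 : ℕ) : ℝ) + 1) * a (i + 1) := by
    intro i _
    have h3 := sum_recipCoeff i
    rw [← Finset.sum_range_reflect] at h3
    have e : 1 / (((i + 1 : ℕ) : ℝ) + 1) = 1 / ((i : ℝ) + 2) := by push_cast; ring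
    rw [e, ← h3, Finset.sum_mul]
    refine Finset.sum_congr rfl fun j hj => ?_
    have hj' : j ≤ i := by simpa [Nat.lt_succ_iff] using hj
    rw [show i + 1 - 1 - j = i - j by omega, show i - (i - j) = j by omega,
      show j + (i - j) = i by omega]
    ring
  rw [Finset.sum_congr rfl h2]
  have h4 := Finset.sum_range_succ' (fun i : ℕ => 1 / ((i : ℝ) + 1) * a i) N
  rw [Finset.sum_range_succ, ha N le_rfl] at h4
  simp only [Nat.cast_zero, zero_add, div_one, one_mul, mul_zero, add_zero] at h4
  linarith

theorem dualSq_eq_coeff_zero_add (q : ℂ[X]) {N : ℕ} (hN : q.natDegree < N) :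
    dualSq q = ‖q.coeff 0‖ ^ 2 +
      ∑ m ∈ Finset.range N, recipCoeff m * dualSq (transMul (PowerSeries.X ^ (m + 1)) q) := by
  have h := sum_recipCoeff_shift N (fun i => ‖q.coeff i‖ ^ 2) (fun i hi => by
    rw [Polynomial.coeff_eq_zero_of_natDegree_lt (by omega)]; simp)
  have h1 : ∀ m, dualSq (transMul (PowerSeries.X ^ (m + 1)) q) =
      ∑ j ∈ Finset.range N, 1 / ((j : ℝ) + 1) * ‖q.coeff (j + m + 1)‖ ^ 2 := by
    intro m
    rw [dualSq_eq_sum _ (support_subset_range ((natDegree_transMul_le _ _).trans_lt hN))]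
    refine Finset.sum_congr rfl fun j _ => ?_
    rw [coeff_transMul_X_pow, show m + 1 + j = j + m + 1 by ring]
    ring
  have h2 : dualSq q = ∑ i ∈ Finset.range N, 1 / ((i : ℝ) + 1) * ‖q.coeff i‖ ^ 2 := by
    rw [dualSq_eq_sum _ (support_subset_range hN)]
    exact Finset.sum_congr rfl fun j _ => by ring
  rw [h2]
  simp only [h1]
  have h3 : ∑ m ∈ Finset.range N, recipCoeff m *
      ∑ j ∈ Finset.range N, 1 / ((j : ℝ) + 1) * ‖q.coeff (j + m + 1)‖ ^ 2 =
      ∑ j ∈ Finset.range N, 1 / ((j : ℝ) + 1) *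
        ∑ m ∈ Finset.range N, recipCoeff m * ‖q.coeff (j + m + 1)‖ ^ 2 := by
    simp only [Finset.mul_sum]
    rw [Finset.sum_comm]
    exact Finset.sum_congr rfl fun _ _ => Finset.sum_congr rfl fun _ _ => by ring
  rw [h3, h]
  ring

section Douglas

variable {E H₁ H₂ : Type*} [AddCommGroup E] [Module ℂ E]
  [NormedAddCommGroup H₁] [InnerProductSpace ℂ H₁] [CompleteSpace H₁]
  [NormedAddCommGroup H₂] [InnerProductSpace ℂ H₂] [CompleteSpace H₂]

/-- Douglas' factorization lemma for contractions. -/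
theorem exists_contraction_of_norm_le (e : E →ₗ[ℂ] H₁) (f : E →ₗ[ℂ] H₂)
    (h : ∀ x, ‖f x‖ ≤ ‖e x‖) :
    ∃ V : H₁ →L[ℂ] H₂, (∀ y, ‖V y‖ ≤ ‖y‖) ∧ ∀ x, V (e x) = f x := by
  let K : Submodule ℂ H₁ := (LinearMap.range e).topologicalClosure
  have hK : IsClosed (K : Set H₁) := Submodule.isClosed_topologicalClosure _
  have : CompleteSpace K := hK.completeSpace_coe
  let e' : E →ₗ[ℂ] K := e.codRestrict K fun x =>
    Submodule.le_topologicalClosure _ (LinearMap.mem_range_self e x)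
  have hd : DenseRange e' := by
    intro ⟨y, hy⟩
    rw [Metric.mem_closure_range_iff]
    intro ε hε
    have hy' : y ∈ closure (Set.range e) := by
      have := hy
      rw [← SetLike.mem_coe, Submodule.topologicalClosure_coe, LinearMap.coe_range] at this
      exact this
    obtain ⟨x, hx⟩ := Metric.mem_closure_range_iff.1 hy' ε hε
    exact ⟨x, hx⟩
  have hn : ∀ x, ‖f x‖ ≤ 1 * ‖e' x‖ := fun x => by simpa [e'] using h x
  refine ⟨(f.extendOfNorm e').comp K.orthogonalProjectionOnto, fun y => ?_, fun x => ?_⟩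
  · have h1 := LinearMap.norm_extendOfNorm_apply_le hd 1 hn (K.orthogonalProjectionOnto y)
    rw [one_mul] at h1
    exact h1.trans (K.norm_orthogonalProjectionOnto_apply_le y)
  · have h2 : K.orthogonalProjectionOnto (e x) = e' x := by
      have := K.orthogonalProjectionOnto_mem_subspace_eq_self (e' x)
      simpa [e'] using this
    rw [ContinuousLinearMap.comp_apply, h2, LinearMap.extendOfNorm_eq hd ⟨1, hn⟩]

/-- The defect operator of a contraction. -/
theorem exists_defect (V : H₁ →L[ℂ] H₂) (hV : ∀ y, ‖V y‖ ≤ ‖y‖) :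
    ∃ D : H₁ →L[ℂ] H₁, ∀ y, ‖D y‖ ^ 2 = ‖y‖ ^ 2 - ‖V y‖ ^ 2 := by
  let P : H₁ →L[ℂ] H₁ := 1 - (ContinuousLinearMap.adjoint V).comp V
  have hPi : ∀ y, inner ℂ (P y) y = ((‖y‖ ^ 2 - ‖V y‖ ^ 2 : ℝ) : ℂ) := by
    intro y
    simp only [P, sub_apply, one_apply_eq_self,
      ContinuousLinearMap.comp_apply, inner_sub_left, ContinuousLinearMap.adjoint_inner_left,
      inner_self_eq_norm_sq_to_K]
    push_cast
    rfl
  have hP : 0 ≤ P := by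
    rw [ContinuousLinearMap.nonneg_iff_isPositive, ContinuousLinearMap.isPositive_iff_complex]
    intro y
    rw [hPi y]
    refine ⟨congrArg Complex.ofReal (Complex.ofReal_re _), ?_⟩
    have := pow_le_pow_left₀ (norm_nonneg _) (hV y) 2
    rw [show RCLike.re ((‖y‖ ^ 2 - ‖V y‖ ^ 2 : ℝ) : ℂ) = ‖y‖ ^ 2 - ‖V y‖ ^ 2 from
      Complex.ofReal_re _]
    linarith
  refine ⟨CFC.sqrt P, fun y => ?_⟩
  have h1 : CFC.sqrt P * CFC.sqrt P = P := CFC.sqrt_mul_sqrt_self P hP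
  have h2 : IsSelfAdjoint (CFC.sqrt P) := (CFC.sqrt_nonneg P).isSelfAdjoint
  have h3 : inner ℂ (P y) y = inner ℂ (CFC.sqrt P y) (CFC.sqrt P y) := by
    conv_lhs => rw [← h1]
    rw [mul_apply_eq_comp]
    conv_lhs => rw [← h2.adjoint_eq]
    rw [ContinuousLinearMap.adjoint_inner_left, h2.adjoint_eq]
  rw [hPi, inner_self_eq_norm_sq_to_K] at h3
  apply Complex.ofReal_injective
  rw [h3]
  push_cast
  rfl

end Douglas

end

section

section Embeddings

variable {K : Type*} [NormedAddCommGroup K]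

theorem norm_sq_lp_of_support {u : lp (fun _ : ℕ => K) 2} {N : ℕ}
    (hu : ∀ i, N ≤ i → u i = 0) : ‖u‖ ^ 2 = ∑ i ∈ Finset.range N, ‖u i‖ ^ 2 := by
  have h := lp.hasSum_norm (p := 2) (by norm_num) u
  have h2 : HasSum (fun i => ‖u i‖ ^ 2) (‖u‖ ^ 2) := by simpa using! h
  exact h2.unique (hasSum_sum_of_ne_finset_zero fun i hi => by
    simp [hu i (by simpa using hi)])

theorem sum_single_apply (w : ℕ → K) (s : Finset ℕ) (i : ℕ) :
    (∑ m ∈ s, lp.single (E := fun _ : ℕ => K) 2 m (w m)) i = if i ∈ s then w i else 0 := by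
  rw [lp.coeFn_sum, Finset.sum_apply]
  simp only [lp.single_apply]
  rw [← Finset.sum_ite_eq s i w]
  refine Finset.sum_congr rfl fun m _ => ?_
  by_cases h : i = m
  · subst h; simp
  · simp [h]

variable [InnerProductSpace ℂ K]

/-- The isometric embedding of polynomials with the dual norm into `ℓ²`. -/
noncomputable def dualEmb : ℂ[X] →ₗ[ℂ] lp (fun _ : ℕ => ℂ) 2 :=
  Polynomial.lsum fun i =>
    (LinearMap.toSpanSingleton ℂ _ (lp.single 2 i (((√((i : ℝ) + 1))⁻¹ : ℝ) : ℂ)))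

theorem dualEmb_apply (q : ℂ[X]) (i : ℕ) :
    dualEmb q i = q.coeff i * ((√((i : ℝ) + 1))⁻¹ : ℝ) := by
  induction q using Polynomial.induction_on' with
  | add p q hp hq => simp [hp, hq, add_mul]
  | monomial j c =>
    rw [dualEmb, Polynomial.lsum_apply, Polynomial.sum_monomial_index _ _ (by simp)]
    by_cases h : i = j
    · subst h; simp
    · simp [h, Ne.symm h, Polynomial.coeff_monomial, lp.single_apply]

theorem norm_sq_dualEmb (q : ℂ[X]) : ‖dualEmb q‖ ^ 2 = dualSq q := by
  rw [norm_sq_lp_of_support (N := q.natDegree + 1),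
    dualSq_eq_sum q (support_subset_range (Nat.lt_succ_self _))]
  · refine Finset.sum_congr rfl fun i _ => ?_
    rw [dualEmb_apply, norm_mul, mul_pow, Complex.norm_real, Real.norm_eq_abs, sq_abs, inv_pow,
      Real.sq_sqrt (by positivity)]
    rfl
  · intro i hi
    rw [dualEmb_apply, Polynomial.coeff_eq_zero_of_natDegree_lt (by omega), zero_mul]

/-- The weighted sequence of values of `ξ` along the shifts of a polynomial. -/
noncomputable def shiftEmb (ξ : ℂ[X] →ₗ[ℂ] K) : ℂ[X] →ₗ[ℂ] lp (fun _ : ℕ => K) 2 :=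
  Polynomial.lsum fun i => LinearMap.toSpanSingleton ℂ _
    (∑ m ∈ Finset.range i, lp.single 2 m
      (((√(recipCoeff m) : ℝ) : ℂ) • ξ (Polynomial.monomial (i - (m + 1)) 1)))

theorem shiftEmb_apply (ξ : ℂ[X] →ₗ[ℂ] K) (q : ℂ[X]) (m : ℕ) :
    shiftEmb ξ q m =
      ((√(recipCoeff m) : ℝ) : ℂ) • ξ (transMul (PowerSeries.X ^ (m + 1)) q) := by
  induction q using Polynomial.induction_on' with
  | add p q hp hq => simp [hp, hq]
  | monomial i c =>
    rw [shiftEmb, Polynomial.lsum_apply, Polynomial.sum_monomial_index _ _ (by simp),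
      LinearMap.toSpanSingleton_apply, lp.coeFn_smul, Pi.smul_apply, sum_single_apply]
    have h : transMul (PowerSeries.X ^ (m + 1)) (Polynomial.monomial i c) =
        if m < i then c • Polynomial.monomial (i - (m + 1)) 1 else 0 := by
      ext j
      rw [coeff_transMul_X_pow]
      split_ifs with h
      · simp only [Polynomial.coeff_smul, Polynomial.coeff_monomial, smul_eq_mul, mul_ite,
          mul_one, mul_zero]
        congr 1
        exact propext ⟨fun _ => by omega, fun _ => by omega⟩
      · rw [Polynomial.coeff_monomial, if_neg (by omega)]; simp
    rw [h]
    simp only [Finset.mem_range]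
    split_ifs
    · rw [map_smul, smul_comm]
    · simp

theorem norm_sq_shiftEmb (ξ : ℂ[X] →ₗ[ℂ] K) (q : ℂ[X]) {N : ℕ} (hN : q.natDegree < N) :
    ‖shiftEmb ξ q‖ ^ 2 = ∑ m ∈ Finset.range N,
      recipCoeff m * ‖ξ (transMul (PowerSeries.X ^ (m + 1)) q)‖ ^ 2 := by
  rw [norm_sq_lp_of_support (N := N)]
  · refine Finset.sum_congr rfl fun m _ => ?_
    rw [shiftEmb_apply, norm_smul, mul_pow, Complex.norm_real, Real.norm_eq_abs, sq_abs,
      Real.sq_sqrt (recipCoeff_nonneg m)]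
  · intro m hm
    have : transMul (PowerSeries.X ^ (m + 1)) q = 0 := by
      ext j
      rw [coeff_transMul_X_pow, Polynomial.coeff_eq_zero_of_natDegree_lt (by omega)]
      simp
    rw [shiftEmb_apply, this]; simp

/-- The state vectors of the linear system with transition map `V` and input vector `e`. -/
noncomputable def stateVec {A : Type*} [AddCommGroup A] [Module ℂ A]
    (V : A × lp (fun _ : ℕ => K) 2 → K) (e : A) : ℕ → K
  | i => V (if i = 0 then e else 0, ∑ m : Fin i, lp.single 2 (m : ℕ)
      (((√(recipCoeff m) : ℝ) : ℂ) • stateVec V e (i - (m + 1))))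
  decreasing_by have := m.2; omega

/-- Solvability of the state equation. -/
theorem exists_state {A : Type*} [AddCommGroup A] [Module ℂ A]
    (V : A × lp (fun _ : ℕ => K) 2 →ₗ[ℂ] K) (e : A) :
    ∃ ξ : ℂ[X] →ₗ[ℂ] K, ∀ q, ξ q = V (q.coeff 0 • e, shiftEmb ξ q) := by
  let v := stateVec (K := K) V e
  let ξ : ℂ[X] →ₗ[ℂ] K := Polynomial.lsum fun i => LinearMap.toSpanSingleton ℂ _ (v i)
  have hξ : ∀ i c, ξ (Polynomial.monomial i c) = c • v i := fun i c => by
    simp [ξ, Polynomial.lsum_apply, Polynomial.sum_monomial_index]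
  refine ⟨ξ, fun q => ?_⟩
  induction q using Polynomial.induction_on' with
  | add p q hp hq =>
    rw [map_add ξ, hp, hq, ← map_add V, map_add (shiftEmb ξ), Polynomial.coeff_add, add_smul]
    rfl
  | monomial i c =>
    have hs : shiftEmb ξ (Polynomial.monomial i c) = c • ∑ m ∈ Finset.range i,
        lp.single 2 m (((√(recipCoeff m) : ℝ) : ℂ) • v (i - (m + 1))) := by
      rw [shiftEmb, Polynomial.lsum_apply, Polynomial.sum_monomial_index _ _ (by simp),
        LinearMap.toSpanSingleton_apply]
      simp only [hξ, one_smul]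
    have hc : (Polynomial.monomial i c).coeff 0 • e = c • (if i = 0 then e else 0) := by
      rw [Polynomial.coeff_monomial]; split_ifs <;> simp
    rw [hξ, hs, hc, show (c • (if i = 0 then e else 0), c • ∑ m ∈ Finset.range i,
        lp.single (E := fun _ : ℕ => K) 2 m (((√(recipCoeff m) : ℝ) : ℂ) • v (i - (m + 1)))) =
        c • ((if i = 0 then e else 0), ∑ m ∈ Finset.range i,
        lp.single (E := fun _ : ℕ => K) 2 m (((√(recipCoeff m) : ℝ) : ℂ) • v (i - (m + 1)))) from
        rfl, map_smul, Finset.sum_range]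
    congr 1
    exact stateVec.eq_1 (K := K) V e i

end Embeddings

end

theorem transMul_X_pow_add (i j : ℕ) (q : ℂ[X]) :
    transMul (PowerSeries.X ^ i) (transMul (PowerSeries.X ^ j) q) =
      transMul (PowerSeries.X ^ (i + j)) q := by
  rw [← transMul_mul, pow_add]

theorem transMul_X_pow_eq_zero {q : ℂ[X]} {i : ℕ} (h : q.natDegree < i) :
    transMul (PowerSeries.X ^ i) q = 0 := by
  ext j
  rw [coeff_transMul_X_pow, Polynomial.coeff_eq_zero_of_natDegree_lt (by omega)]
  simp

/-- The transfer function of a contractive system is a contractive multiplier. -/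
theorem multBound_one_of_state {K : Type*} [NormedAddCommGroup K] [InnerProductSpace ℂ K]
    (ξ : ℂ[X] →ₗ[ℂ] K) (o : ℂ[X] →ₗ[ℂ] ℂ)
    (h : ∀ q, ‖o q‖ ^ 2 + ‖ξ q‖ ^ 2 ≤ ‖q.coeff 0‖ ^ 2 + ‖shiftEmb ξ q‖ ^ 2) (G : ℂ⟦X⟧)
    (hG : ∀ q, pair G q = o q) : MultBound G 1 := by
  intro q
  set N := q.natDegree + 1
  let S : ℕ → ℂ[X] := fun j => transMul (PowerSeries.X ^ j) q
  have hN : ∀ j, (S j).natDegree < N := fun j =>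
    (natDegree_transMul_le _ _).trans_lt (Nat.lt_succ_self _)
  have h0 : S 0 = q := by simp [S, transMul_one]
  have key := sum_recipCoeff_shift N (fun i => ‖ξ (S i)‖ ^ 2) (fun i hi => by
    simp [S, transMul_X_pow_eq_zero (show q.natDegree < i by omega)])
  have h1 : ∀ j, ‖o (S j)‖ ^ 2 + ‖ξ (S j)‖ ^ 2 ≤ ‖q.coeff j‖ ^ 2 +
      ∑ m ∈ Finset.range N, recipCoeff m * ‖ξ (S (j + m + 1))‖ ^ 2 := by
    intro j
    have := h (S j)
    rw [norm_sq_shiftEmb ξ _ (hN j)] at this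
    simp only [S, transMul_X_pow_add, coeff_transMul_X_pow, add_zero] at this
    refine this.trans_eq ?_
    refine congrArg _ (Finset.sum_congr rfl fun m _ => ?_)
    rw [show j + m + 1 = m + 1 + j by omega]
  have h2 : ∑ j ∈ Finset.range N, 1 / ((j : ℝ) + 1) * (‖o (S j)‖ ^ 2 + ‖ξ (S j)‖ ^ 2) ≤
      ∑ j ∈ Finset.range N, 1 / ((j : ℝ) + 1) * (‖q.coeff j‖ ^ 2 +
      ∑ m ∈ Finset.range N, recipCoeff m * ‖ξ (S (j + m + 1))‖ ^ 2) :=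
    Finset.sum_le_sum fun j _ => mul_le_mul_of_nonneg_left (h1 j) (by positivity)
  simp only [mul_add, Finset.sum_add_distrib] at h2
  rw [key] at h2
  have h3 : dualSq (transMul G q) = ∑ j ∈ Finset.range N, 1 / ((j : ℝ) + 1) * ‖o (S j)‖ ^ 2 := by
    rw [dualSq_eq_sum _ (support_subset_range ((natDegree_transMul_le _ _).trans_lt
      (Nat.lt_succ_self _)))]
    refine Finset.sum_congr rfl fun j _ => ?_
    rw [coeff_transMul, mul_comm G, ← pair_transMul, hG]
    ring
  have h4 : dualSq q = ∑ j ∈ Finset.range N, 1 / ((j : ℝ) + 1) * ‖q.coeff j‖ ^ 2 := by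
    rw [dualSq_eq_sum _ (support_subset_range (Nat.lt_succ_self _))]
    exact Finset.sum_congr rfl fun j _ => by ring
  rw [h3, h4, one_pow, one_mul]
  have := sq_nonneg ‖ξ (S 0)‖
  linarith

/-- Leech's factorization theorem for multipliers of the Dirichlet space. -/
theorem exists_factorization {ι : Type*} [Fintype ι] (φ : ι → ℂ⟦X⟧) (ψ : ℂ⟦X⟧)
    (h : ∀ q, dualSq (transMul ψ q) ≤ ∑ k, dualSq (transMul (φ k) q)) :
    ∃ G : ι → ℂ⟦X⟧, ψ = ∑ k, φ k * G k ∧ ∀ k, MultBound (G k) 1 := by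
  classical
  let e : ℂ[X] →ₗ[ℂ] PiLp 2 (fun _ : ι => lp (fun _ : ℕ => ℂ) 2) :=
    (WithLp.linearEquiv 2 ℂ _).symm.toLinearMap ∘ₗ
      LinearMap.pi fun k => dualEmb ∘ₗ transMul (φ k)
  have he : ∀ q, ‖e q‖ ^ 2 = ∑ k, dualSq (transMul (φ k) q) := fun q => by
    rw [PiLp.norm_sq_eq_of_L2]
    exact Finset.sum_congr rfl fun k _ => norm_sq_dualEmb _
  obtain ⟨Y, hY, hYe⟩ := exists_contraction_of_norm_le e (dualEmb ∘ₗ transMul ψ) fun q => by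
    refine (sq_le_sq₀ (norm_nonneg _) (norm_nonneg _)).1 ?_
    rw [he, LinearMap.comp_apply, norm_sq_dualEmb]
    exact h q
  obtain ⟨D, hD⟩ := exists_defect Y hY
  let K := PiLp 2 (fun _ : ι => lp (fun _ : ℕ => ℂ) 2)
  let R : ℂ[X] →ₗ[ℂ] K := D.toLinearMap ∘ₗ e
  have hR : ∀ q, ‖R q‖ ^ 2 = ∑ k, dualSq (transMul (φ k) q) - dualSq (transMul ψ q) := fun q => by
    rw [LinearMap.comp_apply, ContinuousLinearMap.coe_coe, hD, he, hYe, LinearMap.comp_apply,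
      norm_sq_dualEmb]
  let a : ℂ[X] →ₗ[ℂ] EuclideanSpace ℂ ι := (WithLp.linearEquiv 2 ℂ _).symm.toLinearMap ∘ₗ
      LinearMap.pi fun k => Polynomial.lcoeff ℂ 0 ∘ₗ transMul (φ k)
  have ha : ∀ q, ‖a q‖ ^ 2 = ∑ k, ‖(transMul (φ k) q).coeff 0‖ ^ 2 := fun q => by
    rw [EuclideanSpace.norm_sq_eq]; rfl
  let U₁ : ℂ[X] →ₗ[ℂ] WithLp 2 (EuclideanSpace ℂ ι × lp (fun _ : ℕ => K) 2) :=
    (WithLp.linearEquiv 2 ℂ _).symm.toLinearMap ∘ₗ LinearMap.prod a (shiftEmb R)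
  let U₂ : ℂ[X] →ₗ[ℂ] WithLp 2 (ℂ × K) :=
    (WithLp.linearEquiv 2 ℂ _).symm.toLinearMap ∘ₗ
      LinearMap.prod (Polynomial.lcoeff ℂ 0 ∘ₗ transMul ψ) R
  have hU₁ : ∀ q, ‖U₁ q‖ ^ 2 = ‖a q‖ ^ 2 + ‖shiftEmb R q‖ ^ 2 := fun q =>
    WithLp.prod_norm_sq_eq_of_L2 _
  have hU₂ : ∀ q, ‖U₂ q‖ ^ 2 = ‖(transMul ψ q).coeff 0‖ ^ 2 + ‖R q‖ ^ 2 := fun q =>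
    WithLp.prod_norm_sq_eq_of_L2 _
  have hU : ∀ q, ‖U₂ q‖ ^ 2 = ‖U₁ q‖ ^ 2 := by
    intro q
    have hd : ∀ θ, dualSq (transMul θ q) = ‖(transMul θ q).coeff 0‖ ^ 2 +
        ∑ m ∈ Finset.range (q.natDegree + 1), recipCoeff m *
          dualSq (transMul θ (transMul (PowerSeries.X ^ (m + 1)) q)) := fun θ => by
      rw [dualSq_eq_coeff_zero_add _ ((natDegree_transMul_le θ q).trans_lt (Nat.lt_succ_self _))]
      simp only [transMul_comm θ]
    rw [hU₁, hU₂, ha, norm_sq_shiftEmb R q (Nat.lt_succ_self _), hR]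
    simp only [hR, mul_sub, Finset.sum_sub_distrib, Finset.mul_sum]
    rw [hd ψ, Finset.sum_congr rfl fun k _ => hd (φ k), Finset.sum_add_distrib,
      Finset.sum_comm (s := Finset.univ)]
    ring
  obtain ⟨V, hV, hVU⟩ := exists_contraction_of_norm_le U₁ U₂ fun q =>
    (sq_le_sq₀ (norm_nonneg _) (norm_nonneg _)).1 (hU q).le
  let V' : EuclideanSpace ℂ ι × lp (fun _ : ℕ => K) 2 →ₗ[ℂ] ℂ × K :=
    (WithLp.linearEquiv 2 ℂ _).toLinearMap ∘ₗ V.toLinearMap ∘ₗ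
      (WithLp.linearEquiv 2 ℂ _).symm.toLinearMap
  have hV' : ∀ x y, ‖(V' (x, y)).1‖ ^ 2 + ‖(V' (x, y)).2‖ ^ 2 ≤ ‖x‖ ^ 2 + ‖y‖ ^ 2 := by
    intro x y
    have h1 := pow_le_pow_left₀ (norm_nonneg _) (hV (WithLp.toLp 2 (x, y))) 2
    rw [WithLp.prod_norm_sq_eq_of_L2, WithLp.prod_norm_sq_eq_of_L2] at h1
    exact h1
  have hV'U : ∀ q, V' (a q, shiftEmb R q) = ((transMul ψ q).coeff 0, R q) := fun q =>
    congrArg (WithLp.linearEquiv 2 ℂ (ℂ × K)) (hVU q)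
  choose ξ hξ using fun k : ι =>
    exists_state (LinearMap.snd ℂ ℂ K ∘ₗ V') (EuclideanSpace.single k (1 : ℂ))
  let o : ι → ℂ[X] →ₗ[ℂ] ℂ := fun k => LinearMap.fst ℂ ℂ K ∘ₗ V' ∘ₗ
    LinearMap.prod (LinearMap.toSpanSingleton ℂ _ (EuclideanSpace.single k (1 : ℂ)) ∘ₗ
      Polynomial.lcoeff ℂ 0) (shiftEmb (ξ k))
  have ho : ∀ k q, o k q =
      (V' (q.coeff 0 • EuclideanSpace.single k (1 : ℂ), shiftEmb (ξ k) q)).1 := fun k q => rfl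
  let G : ι → ℂ⟦X⟧ := fun k => PowerSeries.mk fun j => o k (Polynomial.monomial j 1)
  have hG : ∀ k q, pair (G k) q = o k q := by
    intro k q
    induction q using Polynomial.induction_on' with
    | add p q hp hq => rw [map_add, map_add, hp, hq]
    | monomial i c =>
      rw [pair_monomial, PowerSeries.coeff_mk, ← mul_one c, ← smul_eq_mul c,
        ← Polynomial.smul_monomial, map_smul]
      simp [mul_comm]
  have hasum : ∀ q, ∑ k, (transMul (φ k) q).coeff 0 • EuclideanSpace.single k (1 : ℂ) = a q := by
    intro q
    ext j
    simp [a, Pi.single_apply]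
  have hshift : ∀ q : ℂ[X],
      (∀ m, R (transMul (PowerSeries.X ^ (m + 1)) q) =
        ∑ k, ξ k (transMul (φ k) (transMul (PowerSeries.X ^ (m + 1)) q))) →
      (a q, shiftEmb R q) = ∑ k, ((transMul (φ k) q).coeff 0 • EuclideanSpace.single k (1 : ℂ),
        shiftEmb (ξ k) (transMul (φ k) q)) := by
    intro q hq
    refine Prod.ext ?_ ?_
    · rw [Prod.fst_sum, hasum]
    · rw [Prod.snd_sum]
      ext1
      funext m
      rw [shiftEmb_apply, hq, lp.coeFn_sum, Finset.sum_apply, Finset.smul_sum]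
      exact Finset.sum_congr rfl fun k _ => by rw [shiftEmb_apply, transMul_comm]
  have hRsum : ∀ N (q : ℂ[X]), q.natDegree < N → R q = ∑ k, ξ k (transMul (φ k) q) := by
    intro N
    induction N with
    | zero => intro q hq; omega
    | succ N ih =>
      intro q hq
      have h2 : (V' (a q, shiftEmb R q)).2 = R q := by rw [hV'U]
      rw [← h2, hshift q fun m => ?_, map_sum, Prod.snd_sum]
      · exact Finset.sum_congr rfl fun k _ => (hξ k _).symm
      · by_cases h0 : q.natDegree < m + 1
        · simp [transMul_X_pow_eq_zero h0]
        · refine ih _ ?_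
          have : (transMul (PowerSeries.X ^ (m + 1)) q).natDegree ≤ q.natDegree - (m + 1) := by
            rw [Polynomial.natDegree_le_iff_coeff_eq_zero]
            intro i hi
            rw [coeff_transMul_X_pow, Polynomial.coeff_eq_zero_of_natDegree_lt (by omega)]
          omega
  refine ⟨G, ?_, fun k => multBound_one_of_state (ξ k) (o k) (fun q => ?_) (G k) (hG k)⟩
  · ext s
    have h1 : ∀ θ : ℂ⟦X⟧, coeff s θ = pair θ (Polynomial.monomial s 1) := fun θ => by
      rw [pair_monomial, mul_one]
    have h2 : coeff s ψ = (V' (a (Polynomial.monomial s 1),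
        shiftEmb R (Polynomial.monomial s 1))).1 := by
      rw [hV'U, coeff_transMul, pow_zero, mul_one, h1]
    rw [h2, hshift _ fun m => hRsum _ _ (Nat.lt_succ_self _), map_sum, Prod.fst_sum, map_sum]
    refine Finset.sum_congr rfl fun k _ => ?_
    rw [← ho, ← hG, pair_transMul, h1]
  · rw [ho, hξ k q]
    refine (hV' _ _).trans_eq ?_
    simp [norm_smul]

section

/-- The real-linear map with Wirtinger derivatives `a` and `b`. -/
noncomputable def wirtMap (a b : ℂ) : ℂ →L[ℝ] ℂ :=
  a • ContinuousLinearMap.id ℝ ℂ + b • conjCLE.toContinuousLinearMap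

theorem wirtMap_apply (a b v : ℂ) : wirtMap a b v = a * v + b * (starRingEnd ℂ) v := by
  simp [wirtMap]

/-- `G` is real differentiable at `z` with Wirtinger derivatives `a` and `b`. -/
def HasWirt (G : ℂ → ℂ) (a b z : ℂ) : Prop := HasFDerivAt G (wirtMap a b) z

namespace HasWirt
variable {G L : ℂ → ℂ} {a b c d z : ℂ}

theorem congr (h : HasWirt G a b z) (hc : a = c) (hd : b = d) : HasWirt G c d z := hc ▸ hd ▸ h

theorem of_hasFDerivAt {T : ℂ →L[ℝ] ℂ} (h : HasFDerivAt G T z)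
    (hT : ∀ v, T v = a * v + b * (starRingEnd ℂ) v) : HasWirt G a b z := by
  have : T = wirtMap a b := ContinuousLinearMap.ext fun v => by rw [hT, wirtMap_apply]
  rw [HasWirt, ← this]
  exact h

theorem of_hasDerivAt (h : HasDerivAt G a z) : HasWirt G a 0 z := by
  have := h.hasFDerivAt.restrictScalars ℝ
  refine of_hasFDerivAt this fun v => ?_
  simp [mul_comm]

theorem conj (h : HasWirt G a b z) :
    HasWirt (fun w => (starRingEnd ℂ) (G w)) ((starRingEnd ℂ) b) ((starRingEnd ℂ) a) z := by
  have := (conjCLE.toContinuousLinearMap.hasFDerivAt).comp z h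
  refine of_hasFDerivAt this fun v => ?_
  simp [wirtMap_apply, add_comm]

theorem mul (h : HasWirt G a b z) (k : HasWirt L c d z) :
    HasWirt (fun w => G w * L w) (a * L z + G z * c) (b * L z + G z * d) z := by
  have := HasFDerivAt.mul h k
  refine of_hasFDerivAt this fun v => ?_
  simp [wirtMap_apply]
  ring

theorem add (h : HasWirt G a b z) (k : HasWirt L c d z) :
    HasWirt (fun w => G w + L w) (a + c) (b + d) z := by
  have := HasFDerivAt.add h k
  refine of_hasFDerivAt this fun v => ?_
  simp [wirtMap_apply]
  ring

theorem sub (h : HasWirt G a b z) (k : HasWirt L c d z) :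
    HasWirt (fun w => G w - L w) (a - c) (b - d) z := by
  have := HasFDerivAt.sub h k
  refine of_hasFDerivAt this fun v => ?_
  simp [wirtMap_apply]
  ring

theorem sum {ι : Type*} {s : Finset ι} {G : ι → ℂ → ℂ} {a b : ι → ℂ}
    (h : ∀ i ∈ s, HasWirt (G i) (a i) (b i) z) :
    HasWirt (fun w => ∑ i ∈ s, G i w) (∑ i ∈ s, a i) (∑ i ∈ s, b i) z := by
  have := HasFDerivAt.fun_sum h
  refine of_hasFDerivAt this fun v => ?_
  simp [wirtMap_apply, Finset.sum_add_distrib, Finset.sum_mul]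

theorem inv (h : HasWirt G a b z) (h0 : G z ≠ 0) :
    HasWirt (fun w => (G w)⁻¹) (-a / G z ^ 2) (-b / G z ^ 2) z := by
  have := ((hasDerivAt_inv h0).hasFDerivAt.restrictScalars ℝ).comp z h
  refine of_hasFDerivAt this fun v => ?_
  simp [wirtMap_apply]
  ring

theorem polynomial (p : ℂ[X]) (z : ℂ) : HasWirt (fun w => p.eval w) (p.derivative.eval z) 0 z :=
  of_hasDerivAt (p.hasDerivAt z)

end HasWirt

/-- Normalized area measure on the closed unit disc. -/
noncomputable def discMeasure : Measure ℂ :=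
  ENNReal.ofReal Real.pi⁻¹ • volume.restrict (closedBall 0 1)

theorem integral_closedBall_eq_polar {F : ℂ → ℂ} (hF : ContinuousOn F (closedBall 0 1)) :
    ∫ z in closedBall (0 : ℂ) 1, F z =
      ∫ r in (0 : ℝ)..1, ∫ θ in (-Real.pi)..Real.pi, (r : ℂ) * F (r * exp (θ * I)) := by
  rw [← integral_indicator measurableSet_closedBall, ← Complex.integral_comp_polarCoord_symm]
  have h1 : ∀ p : ℝ × ℝ, Complex.polarCoord.symm p = p.1 * exp (p.2 * I) := fun p => by
    rw [Complex.polarCoord_symm_apply, exp_mul_I, Complex.ofReal_cos, Complex.ofReal_sin]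
  set s : Set (ℝ × ℝ) := Set.Ioc (0 : ℝ) 1 ×ˢ Set.Ioc (-Real.pi) Real.pi with hs
  have hsm : MeasurableSet s := measurableSet_Ioc.prod measurableSet_Ioc
  have h2 : ∫ p in polarCoord.target, p.1 • (closedBall (0 : ℂ) 1).indicator F
        (Complex.polarCoord.symm p) = ∫ p in s, (p.1 : ℂ) * F (p.1 * exp (p.2 * I)) := by
    have ht : polarCoord.target =ᵐ[volume] Set.Ioi (0 : ℝ) ×ˢ Set.Ioc (-Real.pi) Real.pi := by
      rw [Measure.volume_eq_prod]
      exact Measure.set_prod_ae_eq Filter.EventuallyEq.rfl Ioo_ae_eq_Ioc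
    have hm : MeasurableSet (Set.Ioi (0 : ℝ) ×ˢ Set.Ioc (-Real.pi) Real.pi) :=
      measurableSet_Ioi.prod measurableSet_Ioc
    rw [setIntegral_congr_set ht, ← integral_indicator hm, ← integral_indicator hsm]
    congr 1
    ext p
    by_cases hp : 0 < p.1
    · by_cases hp1 : p.1 ≤ 1
      · simp [Set.indicator, hs, hp, hp1, abs_of_pos hp, h1, -Complex.polarCoord_symm_apply]
      · have : Complex.polarCoord.symm p ∉ closedBall (0 : ℂ) 1 := by
          rw [mem_closedBall_zero_iff, norm_polarCoord_symm, abs_of_pos hp]; exact hp1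
        simp [Set.indicator, hs, hp1, this, -Complex.polarCoord_symm_apply]
    · simp [Set.indicator, hs, hp]
  have hint : IntegrableOn (fun p : ℝ × ℝ => (p.1 : ℂ) * F (p.1 * exp (p.2 * I))) s := by
    refine IntegrableOn.mono_set (t := Set.Icc (0 : ℝ) 1 ×ˢ Set.Icc (-Real.pi) Real.pi) ?_
      (Set.prod_mono Set.Ioc_subset_Icc_self Set.Ioc_subset_Icc_self)
    refine ContinuousOn.integrableOn_compact (isCompact_Icc.prod isCompact_Icc) ?_
    refine ContinuousOn.mul (by fun_prop) (hF.comp (by fun_prop) ?_)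
    rintro ⟨r, θ⟩ ⟨hr, -⟩
    simp only [Set.mem_Icc] at hr
    simp [norm_exp_ofReal_mul_I, abs_of_nonneg hr.1, hr.2]
  rw [h2, Measure.volume_eq_prod, setIntegral_prod _ hint, intervalIntegral.integral_of_le (by simp)]
  refine setIntegral_congr_fun measurableSet_Ioc fun r _ => ?_
  rw [intervalIntegral.integral_of_le (by linarith [Real.pi_pos])]

theorem circleAverage_eq_integral_symm (F : ℂ → ℂ) :
    Real.circleAverage F 0 1 =
      (2 * Real.pi)⁻¹ • ∫ θ in (-Real.pi)..Real.pi, F (exp (θ * I)) := by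
  rw [Real.circleAverage_eq_integral_add (-Real.pi)]
  congr 1
  rw [intervalIntegral.integral_comp_add_right (fun θ => F (circleMap 0 1 θ))]
  simp only [circleMap, ofReal_one, one_mul, zero_add]
  congr 1; ring

/-- The Cauchy-Green formula on the unit disc. -/
theorem circleAverage_mul_eq_integral {G a b : ℂ → ℂ}
    (hG : ∀ z ∈ closedBall (0 : ℂ) 1, HasWirt G (a z) (b z) z)
    (hb : ContinuousOn b (closedBall 0 1)) :
    Real.circleAverage (fun z => z * G z) 0 1 = ∫ z, b z ∂discMeasure := by
  have hGc : ContinuousOn G (closedBall 0 1) := fun z hz =>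
    (HasFDerivAt.continuousAt (hG z hz)).continuousWithinAt
  have hpol : ∀ {p : ℝ × ℝ}, p ∈ Set.uIcc (0 : ℝ) 1 ×ˢ Set.uIcc (-Real.pi) Real.pi →
      (p.1 : ℂ) * exp (p.2 * I) ∈ closedBall (0 : ℂ) 1 := by
    rintro ⟨r, θ⟩ ⟨hr, -⟩
    simp only [Set.uIcc_of_le zero_le_one, Set.mem_Icc] at hr
    simp [norm_exp_ofReal_mul_I, abs_of_nonneg hr.1, hr.2]
  let P : ℝ × ℝ → ℂ := fun p => p.1 * exp (p.2 * I)
  let dfst : ℝ × ℝ →L[ℝ] ℂ := ofRealCLM.comp (ContinuousLinearMap.fst ℝ ℝ ℝ)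
  let dsnd : ℝ × ℝ →L[ℝ] ℂ := ofRealCLM.comp (ContinuousLinearMap.snd ℝ ℝ ℝ)
  have hE : ∀ p : ℝ × ℝ, HasFDerivAt (fun p : ℝ × ℝ => exp (p.2 * I))
      ((I * exp (p.2 * I)) • dsnd) p := fun p => by
    have h1 : HasDerivAt (fun w : ℂ => exp (w * I)) (exp (p.2 * I) * (1 * I)) (p.2 : ℂ) :=
      ((hasDerivAt_id _).mul_const I).cexp
    have h2 := (h1.hasFDerivAt.restrictScalars ℝ).comp p (dsnd.hasFDerivAt (x := p))
    refine h2.congr_fderiv (ContinuousLinearMap.ext fun v => ?_)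
    simp [dsnd, mul_comm]
  have hP : ∀ p : ℝ × ℝ, HasFDerivAt P ((p.1 : ℂ) • ((I * exp (p.2 * I)) • dsnd) +
      exp (p.2 * I) • dfst) p := fun p => (dfst.hasFDerivAt (x := p)).mul (hE p)
  have hGP : ∀ p : ℝ × ℝ, P p ∈ closedBall (0 : ℂ) 1 → HasFDerivAt (fun p => G (P p))
      ((wirtMap (a (P p)) (b (P p))).comp ((p.1 : ℂ) • ((I * exp (p.2 * I)) • dsnd) +
      exp (p.2 * I) • dfst)) p := fun p hp => HasFDerivAt.comp p (hG _ hp) (hP p)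
  have hIooIcc : ∀ x : ℝ × ℝ, x ∈ Set.Ioo (min (0 : ℝ) 1) (max (0 : ℝ) 1) ×ˢ
      Set.Ioo (min (-Real.pi) Real.pi) (max (-Real.pi) Real.pi) →
      x ∈ Set.uIcc (0 : ℝ) 1 ×ˢ Set.uIcc (-Real.pi) Real.pi := fun x hx =>
    ⟨Set.Ioo_subset_Icc_self hx.1, Set.Ioo_subset_Icc_self hx.2⟩
  have hPc : Continuous P := by fun_prop
  have hGPc : ContinuousOn (fun p => G (P p))
      (Set.uIcc (0 : ℝ) 1 ×ˢ Set.uIcc (-Real.pi) Real.pi) :=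
    hGc.comp hPc.continuousOn fun p hp => hpol hp
  have hbPc : ContinuousOn (fun p => b (P p))
      (Set.uIcc (0 : ℝ) 1 ×ˢ Set.uIcc (-Real.pi) Real.pi) :=
    hb.comp hPc.continuousOn fun p hp => hpol hp
  let f' : ℝ × ℝ → ℝ × ℝ →L[ℝ] ℂ := fun p => P p • ((wirtMap (a (P p)) (b (P p))).comp
    ((p.1 : ℂ) • ((I * exp (p.2 * I)) • dsnd) + exp (p.2 * I) • dfst)) + G (P p) •
      ((p.1 : ℂ) • ((I * exp (p.2 * I)) • dsnd) + exp (p.2 * I) • dfst)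
  let g' : ℝ × ℝ → ℝ × ℝ →L[ℝ] ℂ := fun p => (I * exp (p.2 * I)) •
    ((wirtMap (a (P p)) (b (P p))).comp ((p.1 : ℂ) • ((I * exp (p.2 * I)) • dsnd) +
      exp (p.2 * I) • dfst)) + G (P p) • (I • ((I * exp (p.2 * I)) • dsnd))
  have hdiv : ∀ p : ℝ × ℝ, f' p (1, 0) + g' p (0, 1) = 2 * ((p.1 : ℂ) * b (P p)) := by
    intro p
    have hc : exp (p.2 * I) * (starRingEnd ℂ) (exp (p.2 * I)) = 1 := by
      rw [mul_conj, normSq_eq_norm_sq, norm_exp_ofReal_mul_I]; simp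
    have hI : I * I = -1 := I_mul_I
    simp only [f', g', P, dfst, dsnd, add_apply,
      smul_apply, ContinuousLinearMap.comp_apply, wirtMap_apply,
      ContinuousLinearMap.coe_fst', ContinuousLinearMap.coe_snd', ofRealCLM_apply, map_add,
      map_mul, smul_eq_mul, conj_ofReal, conj_I, ofReal_one, map_one, map_zero]
    generalize (starRingEnd ℂ) (exp (p.2 * I)) = e' at hc ⊢
    generalize exp (p.2 * I) = e at hc ⊢
    linear_combination (p.1 * a (↑p.1 * e) * e ^ 2 - p.1 * b (↑p.1 * e) * e * e' +
      e * G (↑p.1 * e)) * hI + 2 * p.1 * b (p.1 * e) * hc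
  have key := integral2_divergence_prod_of_hasFDerivAt (fun p => P p * G (P p))
    (fun p => (I * exp (p.2 * I)) * G (P p)) f' g' 0 (-Real.pi) 1 Real.pi
    (hPc.continuousOn.mul hGPc) (ContinuousOn.mul (by fun_prop) hGPc)
    (fun p hp => (hP p).mul (hGP p (hpol (hIooIcc p hp))))
    (fun p hp => ((hE p).const_mul I).mul (hGP p (hpol (hIooIcc p hp))))
    (by
      simp only [hdiv]
      refine ContinuousOn.integrableOn_compact (isCompact_uIcc.prod isCompact_uIcc) ?_
      exact continuousOn_const.mul (ContinuousOn.mul (by fun_prop) hbPc))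
  simp only [hdiv, intervalIntegral.integral_const_mul] at key
  have hpi : exp (-(Real.pi : ℂ) * I) = exp (Real.pi * I) := by
    rw [exp_pi_mul_I, neg_mul, exp_neg, exp_pi_mul_I]; norm_num
  simp only [P, ofReal_neg, hpi, sub_self, zero_add, ofReal_zero, zero_mul,
    intervalIntegral.integral_zero, sub_zero, ofReal_one, one_mul] at key
  rw [circleAverage_eq_integral_symm, ← key, discMeasure, integral_smul_measure,
    ENNReal.toReal_ofReal (by positivity), integral_closedBall_eq_polar hb]
  simp only [intervalIntegral.integral_const_mul, real_smul]
  push_cast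
  have : (Real.pi : ℂ) ≠ 0 := by exact_mod_cast Real.pi_ne_zero
  generalize (∫ r in (0 : ℝ)..1, (r : ℂ) * ∫ θ in (-Real.pi)..Real.pi,
    b (r * exp (θ * I))) = J
  field_simp

end

theorem circleAverage_conj (F : ℂ → ℂ) :
    Real.circleAverage (fun z => (starRingEnd ℂ) (F z)) 0 1 =
      (starRingEnd ℂ) (Real.circleAverage F 0 1) := by
  simp only [Real.circleAverage, intervalIntegral.integral_of_le Real.two_pi_pos.le, integral_conj,
    real_smul, map_mul, conj_ofReal]

theorem integral_disc_conj (F : ℂ → ℂ) :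
    ∫ z, (starRingEnd ℂ) (F z) ∂discMeasure = (starRingEnd ℂ) (∫ z, F z ∂discMeasure) :=
  integral_conj

/-- The conjugate Cauchy-Green formula on the unit disc. -/
theorem circleAverage_conj_mul_eq_integral {G a b : ℂ → ℂ}
    (hG : ∀ z ∈ closedBall (0 : ℂ) 1, HasWirt G (a z) (b z) z)
    (ha : ContinuousOn a (closedBall 0 1)) :
    Real.circleAverage (fun z => (starRingEnd ℂ) z * G z) 0 1 = ∫ z, a z ∂discMeasure := by
  have h := circleAverage_mul_eq_integral (fun z hz => (hG z hz).conj)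
    (continuous_conj.comp_continuousOn ha)
  rw [integral_disc_conj] at h
  have h2 := circleAverage_conj (fun z => (starRingEnd ℂ) z * G z)
  simp only [map_mul, conj_conj] at h2
  rw [h2] at h
  exact (starRingEnd ℂ).injective h

instance : IsFiniteMeasure discMeasure := by
  unfold discMeasure
  have : IsFiniteMeasure (volume.restrict (closedBall (0 : ℂ) 1)) :=
    ⟨by rw [Measure.restrict_apply_univ]; exact measure_closedBall_lt_top⟩
  exact Measure.smul_finite _ ENNReal.ofReal_ne_top

theorem ae_disc {p : ℂ → Prop} (h : ∀ z ∈ closedBall (0 : ℂ) 1, p z) : ∀ᵐ z ∂discMeasure, p z :=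
  Measure.ae_smul_measure ((ae_restrict_mem measurableSet_closedBall).mono h) _

theorem integrable_disc {E : Type*} [NormedAddCommGroup E] {F : ℂ → E}
    (hF : ContinuousOn F (closedBall 0 1)) : Integrable F discMeasure :=
  (hF.integrableOn_compact (isCompact_closedBall _ _)).integrable.smul_measure ENNReal.ofReal_ne_top

theorem integral_disc_mono {F G : ℂ → ℝ} (hF : ContinuousOn F (closedBall 0 1))
    (hG : ContinuousOn G (closedBall 0 1)) (h : ∀ z ∈ closedBall (0 : ℂ) 1, F z ≤ G z) :
    ∫ z, F z ∂discMeasure ≤ ∫ z, G z ∂discMeasure :=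
  integral_mono_ae (integrable_disc hF) (integrable_disc hG) (ae_disc h)

theorem conj_mul_of_mem_sphere {z : ℂ} (hz : z ∈ sphere (0 : ℂ) |1|) :
    (starRingEnd ℂ) z * z = 1 := by
  rw [abs_one, mem_sphere_zero_iff_norm] at hz
  rw [conj_mul', hz]; simp

theorem circleAverage_pow_succ (n : ℕ) : Real.circleAverage (fun z : ℂ => z ^ (n + 1)) 0 1 = 0 := by
  have h := circleAverage_mul_eq_integral (G := fun z => z ^ n) (b := fun _ => 0)
    (fun z _ => HasWirt.of_hasDerivAt (hasDerivAt_pow n z)) continuousOn_const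
  simpa [← pow_succ'] using h

theorem circleAverage_pow_mul_conj_pow (m n : ℕ) :
    Real.circleAverage (fun z : ℂ => z ^ m * (starRingEnd ℂ) z ^ n) 0 1 = if m = n then 1 else 0 := by
  have key : ∀ i j : ℕ, Real.circleAverage (fun z : ℂ => z ^ (i + j + 1) * (starRingEnd ℂ) z ^ i) 0 1
      = 0 := by
    intro i j
    refine (Real.circleAverage_congr_sphere fun z hz => ?_).trans (circleAverage_pow_succ j)
    have h := conj_mul_of_mem_sphere hz
    calc z ^ (i + j + 1) * (starRingEnd ℂ) z ^ i = ((starRingEnd ℂ) z * z) ^ i * z ^ (j + 1) := by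
          ring
      _ = z ^ (j + 1) := by rw [h, one_pow, one_mul]
  rcases lt_trichotomy m n with h | h | h
  · rw [if_neg h.ne]
    have h2 := circleAverage_conj (fun z => z ^ n * (starRingEnd ℂ) z ^ m)
    have h3 := key m (n - m - 1)
    rw [show m + (n - m - 1) + 1 = n by omega] at h3
    rw [h3, map_zero] at h2
    rw [← h2]
    congr 1
    ext z; simp [mul_comm]
  · subst h
    rw [if_pos rfl]
    refine Real.circleAverage_const_on_circle fun z hz => ?_
    rw [← mul_pow, mul_comm, conj_mul_of_mem_sphere hz, one_pow]
  · rw [if_neg h.ne']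
    have h3 := key n (m - n - 1)
    rwa [show n + (m - n - 1) + 1 = m by omega] at h3

theorem integral_pow_mul_conj_pow (m n : ℕ) :
    ∫ z, z ^ m * (starRingEnd ℂ) z ^ n ∂discMeasure = if m = n then ((m : ℂ) + 1)⁻¹ else 0 := by
  have h := circleAverage_mul_eq_integral (a := fun z => m * z ^ (m - 1) *
      (starRingEnd ℂ) z ^ (n + 1)) (b := fun z => ((n : ℂ) + 1) * (z ^ m * (starRingEnd ℂ) z ^ n))
    (G := fun z => z ^ m * (starRingEnd ℂ) z ^ (n + 1)) (fun z _ => by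
      have h1 := (HasWirt.of_hasDerivAt (hasDerivAt_pow m z)).mul
        (HasWirt.of_hasDerivAt (hasDerivAt_pow (n + 1) z)).conj
      simp only [map_pow] at h1
      refine h1.congr ?_ ?_
      · simp
      · simp; ring) (by fun_prop)
  rw [integral_const_mul] at h
  have h2 := circleAverage_pow_mul_conj_pow (m + 1) (n + 1)
  have h3 : (fun z : ℂ => z * (z ^ m * (starRingEnd ℂ) z ^ (n + 1))) =
      fun z => z ^ (m + 1) * (starRingEnd ℂ) z ^ (n + 1) := by ext z; ring
  rw [h3, h2] at h
  have hn : (n : ℂ) + 1 ≠ 0 := by exact_mod_cast n.succ_ne_zero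
  simp only [Nat.add_right_cancel_iff] at h
  split_ifs at h ⊢ with hmn
  · subst hmn
    exact eq_inv_of_mul_eq_one_right h.symm
  · rcases mul_eq_zero.1 h.symm with h | h
    · exact absurd h hn
    · exact h

theorem integral_mul_conj_eval {g : ℂ → ℂ} (hg : ContinuousOn g (closedBall 0 1)) (p : ℂ[X])
    {N : ℕ} (hN : p.support ⊆ Finset.range N) :
    ∫ z, g z * (starRingEnd ℂ) (p.eval z) ∂discMeasure =
      ∑ i ∈ Finset.range N, (starRingEnd ℂ) (p.coeff i) *
        ∫ z, g z * (starRingEnd ℂ) z ^ i ∂discMeasure := by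
  have h : ∀ z, g z * (starRingEnd ℂ) (p.eval z) =
      ∑ i ∈ Finset.range N, (starRingEnd ℂ) (p.coeff i) * (g z * (starRingEnd ℂ) z ^ i) := by
    intro z
    rw [Polynomial.eval_eq_sum, Polynomial.sum_def, map_sum, Finset.mul_sum,
      Finset.sum_subset hN fun i _ hi => by simp [Polynomial.notMem_support_iff.1 hi]]
    exact Finset.sum_congr rfl fun i _ => by rw [map_mul, map_pow]; ring
  simp only [h]
  rw [integral_finsetSum]
  · simp only [integral_const_mul]
  · intro i _
    exact integrable_disc (continuousOn_const.mul (hg.mul (by fun_prop)))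

theorem integral_eval_mul_conj_pow (p : ℂ[X]) (n : ℕ) :
    ∫ z, p.eval z * (starRingEnd ℂ) z ^ n ∂discMeasure = p.coeff n / ((n : ℂ) + 1) := by
  have h := integral_mul_conj_eval (g := fun z => z ^ n) (by fun_prop) p
    (support_subset_range (N := max p.natDegree n + 1) (by omega))
  simp only [integral_pow_mul_conj_pow] at h
  have h2 := integral_disc_conj fun z => z ^ n * (starRingEnd ℂ) (p.eval z)
  simp only [map_mul, conj_conj, map_pow] at h2
  rw [h] at h2
  simp only [mul_comm (Polynomial.eval _ _)]
  rw [h2]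
  simp [div_eq_mul_inv]

theorem integral_norm_sq_eval (p : ℂ[X]) :
    ∫ z, ‖p.eval z‖ ^ 2 ∂discMeasure = dualSq p := by
  have h := integral_mul_conj_eval (g := fun z => p.eval z) (by fun_prop) p
    (support_subset_range (Nat.lt_succ_self _))
  simp only [integral_eval_mul_conj_pow, mul_conj'] at h
  have h2 : ((∫ z, ‖p.eval z‖ ^ 2 ∂discMeasure : ℝ) : ℂ) = (dualSq p : ℝ) := by
    rw [show ((∫ z, ‖p.eval z‖ ^ 2 ∂discMeasure : ℝ) : ℂ) =
      ∫ z, ((‖p.eval z‖ ^ 2 : ℝ) : ℂ) ∂discMeasure from integral_ofReal.symm, dualSq_eq_sum p (support_subset_range (Nat.lt_succ_self _))]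
    push_cast
    rw [h]
    refine Finset.sum_congr rfl fun i _ => ?_
    rw [← conj_mul']; ring
  exact_mod_cast h2

/-- Bessel's inequality for the monomials in the Bergman space. -/
theorem sum_norm_sq_integral_le {g : ℂ → ℂ} (hg : ContinuousOn g (closedBall 0 1)) (N : ℕ) :
    ∑ m ∈ Finset.range N, ((m : ℝ) + 1) *
      ‖∫ z, g z * (starRingEnd ℂ) z ^ m ∂discMeasure‖ ^ 2 ≤ ∫ z, ‖g z‖ ^ 2 ∂discMeasure := by
  set c : ℕ → ℂ := fun m => ∫ z, g z * (starRingEnd ℂ) z ^ m ∂discMeasure with hc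
  set p : ℂ[X] := ∑ m ∈ Finset.range N, Polynomial.monomial m (((m : ℂ) + 1) * c m) with hp
  have hcoeff : ∀ i, p.coeff i = if i < N then ((i : ℂ) + 1) * c i else 0 := fun i => by
    simp [hp, Polynomial.finsetSum_coeff, Polynomial.coeff_monomial]
  have hsupp : p.support ⊆ Finset.range N := fun i hi => by
    rw [Polynomial.mem_support_iff, hcoeff] at hi
    simp only [Finset.mem_range]
    by_contra h
    simp [h] at hi
  have h1 : ∫ z, g z * (starRingEnd ℂ) (p.eval z) ∂discMeasure =
      ((∑ m ∈ Finset.range N, ((m : ℝ) + 1) * ‖c m‖ ^ 2 : ℝ) : ℂ) := by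
    rw [integral_mul_conj_eval hg p hsupp]
    push_cast
    refine Finset.sum_congr rfl fun i hi => ?_
    rw [hcoeff, if_pos (Finset.mem_range.1 hi), map_mul, ← conj_mul']
    simp only [map_add, map_natCast, map_one, hc]
    ring
  have h2 : ∫ z, ‖p.eval z‖ ^ 2 ∂discMeasure = ∑ m ∈ Finset.range N, ((m : ℝ) + 1) * ‖c m‖ ^ 2 := by
    rw [integral_norm_sq_eval, dualSq_eq_sum p hsupp]
    refine Finset.sum_congr rfl fun i hi => ?_
    rw [hcoeff, if_pos (Finset.mem_range.1 hi), norm_mul, norm_natCast_add_one]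
    have : (i : ℝ) + 1 ≠ 0 := by positivity
    field_simp
  have h3 : ∫ z, ‖g z - p.eval z‖ ^ 2 ∂discMeasure = ∫ z, ‖g z‖ ^ 2 ∂discMeasure -
      2 * (∫ z, g z * (starRingEnd ℂ) (p.eval z) ∂discMeasure).re +
        ∫ z, ‖p.eval z‖ ^ 2 ∂discMeasure := by
    have hi1 : Integrable (fun z => ‖g z‖ ^ 2) discMeasure := integrable_disc (hg.norm.pow 2)
    have hi2 : Integrable (fun z => g z * (starRingEnd ℂ) (p.eval z)) discMeasure :=
      integrable_disc (hg.mul (by fun_prop))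
    have hi3 : Integrable (fun z => ‖p.eval z‖ ^ 2) discMeasure := integrable_disc (by fun_prop)
    have hre : (∫ z, g z * (starRingEnd ℂ) (p.eval z) ∂discMeasure).re =
        ∫ z, (g z * (starRingEnd ℂ) (p.eval z)).re ∂discMeasure := (integral_re hi2).symm
    have hi4 : Integrable (fun z => 2 * (g z * (starRingEnd ℂ) (p.eval z)).re) discMeasure :=
      hi2.re.const_mul 2
    rw [hre, ← integral_const_mul, ← integral_sub hi1 hi4, ← integral_add (f := fun z => ‖g z‖ ^ 2 -
      2 * (g z * (starRingEnd ℂ) (p.eval z)).re) (hi1.sub hi4) hi3]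
    refine integral_congr_ae (Filter.Eventually.of_forall fun z => ?_)
    simp only [← normSq_eq_norm_sq, normSq_sub]
    ring
  have h4 : 0 ≤ ∫ z, ‖g z - p.eval z‖ ^ 2 ∂discMeasure := integral_nonneg fun z => by positivity
  rw [h3, h1, h2, ofReal_re] at h4
  linarith

theorem MultBound.norm_eval_sq_le {f : ℂ[X]} (hf : MultBound f 1) {w : ℂ} (hw : ‖w‖ ≤ 1) (M : ℕ) :
    ‖f.eval w‖ ^ 2 ≤ 1 + f.natDegree / ((M : ℝ) + 1) := by
  set d := f.natDegree with hd
  set N := M + 1 + d with hN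
  set q : ℂ[X] := ∑ i ∈ Finset.range N, Polynomial.monomial i (w ^ i) with hq
  have hcoeff : ∀ i, q.coeff i = if i < N then w ^ i else 0 := fun i => by
    simp [hq, Polynomial.finsetSum_coeff, Polynomial.coeff_monomial]
  have hsupp : q.natDegree < N + 1 := by
    refine Nat.lt_succ_of_le (Polynomial.natDegree_le_iff_coeff_eq_zero.2 fun m hm => ?_)
    rw [hcoeff, if_neg (by omega)]
  have hT : ∀ m < M + 1, (transMul f q).coeff m = f.eval w * w ^ m := by
    intro m hm
    rw [coeff_transMul_eq_sum _ _ _ hsupp, Polynomial.eval_eq_sum_range' (n := N + 1) (by omega),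
      Finset.sum_mul]
    refine Finset.sum_congr rfl fun j _ => ?_
    rw [Polynomial.coeff_coe, hcoeff]
    split_ifs with h
    · rw [pow_add]; ring
    · rw [Polynomial.coeff_eq_zero_of_natDegree_lt (by omega)]; simp
  set s : ℕ → ℝ := fun K => ∑ m ∈ Finset.range K, (‖w‖ ^ m) ^ 2 / ((m : ℝ) + 1) with hs
  have h1 : ‖f.eval w‖ ^ 2 * s (M + 1) ≤ dualSq (transMul f q) := by
    have h2 := natDegree_transMul_le f q
    rw [dualSq_eq_sum _ (support_subset_range (N := N + 1) (by omega)), hs, Finset.mul_sum]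
    refine (Finset.sum_le_sum fun i hi => ?_).trans (Finset.sum_le_sum_of_subset_of_nonneg
      (Finset.range_subset_range.2 (show M + 1 ≤ N + 1 by omega)) fun i _ _ => by positivity)
    rw [hT i (Finset.mem_range.1 hi), norm_mul, norm_pow, mul_pow, mul_div_assoc]
  have h2 : dualSq q = s N := by
    rw [dualSq_eq_sum q (support_subset_range hsupp), Finset.sum_range_succ, hcoeff N]
    simp only [lt_irrefl, if_false, norm_zero]
    rw [zero_pow two_ne_zero, zero_div, add_zero]
    refine Finset.sum_congr rfl fun i hi => ?_
    rw [hcoeff, if_pos (Finset.mem_range.1 hi), norm_pow]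
  have h3 : s N ≤ s (M + 1) + d / ((M : ℝ) + 1) := by
    rw [hs, hN]
    simp only [Finset.sum_range_add]
    gcongr
    calc _ ≤ ∑ _i ∈ Finset.range d, 1 / ((M : ℝ) + 1) := by
          refine Finset.sum_le_sum fun i _ => ?_
          have : (‖w‖ ^ (M + 1 + i)) ^ 2 ≤ 1 := pow_le_one₀ (by positivity)
            (pow_le_one₀ (norm_nonneg _) hw)
          push_cast
          gcongr
          linarith [(Nat.cast_nonneg i : (0 : ℝ) ≤ i)]
      _ = _ := by simp [div_eq_mul_inv]
  have h4 : 1 ≤ s (M + 1) := by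
    rw [hs]
    simp only [Finset.sum_range_succ']
    simp only [pow_zero, one_pow, Nat.cast_zero, zero_add, div_one, le_add_iff_nonneg_left]
    positivity
  have h5 := hf q
  rw [h2] at h5
  have h6 : (0 : ℝ) ≤ d / ((M : ℝ) + 1) := by positivity
  nlinarith [sq_nonneg ‖f.eval w‖]

theorem MultBound.norm_eval_le_one {f : ℂ[X]} (hf : MultBound f 1) {w : ℂ} (hw : ‖w‖ ≤ 1) :
    ‖f.eval w‖ ≤ 1 := by
  have h : ‖f.eval w‖ ^ 2 ≤ 1 := by
    refine ge_of_tendsto' (x := Filter.atTop) ?_ (hf.norm_eval_sq_le hw)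
    have := (tendsto_one_div_add_atTop_nhds_zero_nat (𝕜 := ℝ)).const_mul (f.natDegree : ℝ)
    simpa [div_eq_mul_inv] using this.const_add 1
  exact (sq_le_one_iff₀ (norm_nonneg _)).1 h

theorem dualSq_le_dirSq (h : ℂ[X]) : dualSq h ≤ dirSq h :=
  Finset.sum_le_sum fun i _ => by
    have : (1 : ℝ) ≤ (i : ℝ) + 1 := by linarith [(Nat.cast_nonneg i : (0 : ℝ) ≤ i)]
    calc ‖h.coeff i‖ ^ 2 / ((i : ℝ) + 1) ≤ ‖h.coeff i‖ ^ 2 := div_le_self (by positivity) this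
      _ ≤ _ := le_mul_of_one_le_left (by positivity) this

theorem dualSq_derivative_le (h : ℂ[X]) : dualSq h.derivative ≤ dirSq h := by
  set N := h.natDegree + 1
  have hd := Polynomial.natDegree_derivative_le h
  rw [dualSq_eq_sum _ (support_subset_range (N := N) (by omega)),
    dirSq_eq_sum h (support_subset_range (N := N + 1) (by omega)), Finset.sum_range_succ' _ N]
  refine le_add_of_le_of_nonneg (Finset.sum_le_sum fun i _ => ?_) (by positivity)
  rw [Polynomial.coeff_derivative, norm_mul, norm_natCast_add_one, mul_pow, mul_div_assoc]
  have : (i : ℝ) + 1 ≠ 0 := by positivity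
  field_simp
  push_cast
  nlinarith [sq_nonneg ‖h.coeff (i + 1)‖]

theorem integral_norm_sq_eval_le (h : ℂ[X]) :
    ∫ z, ‖h.eval z‖ ^ 2 ∂discMeasure ≤ dirSq h :=
  (integral_norm_sq_eval h).trans_le (dualSq_le_dirSq h)

theorem integral_norm_sq_eval_derivative_le (h : ℂ[X]) :
    ∫ z, ‖h.derivative.eval z‖ ^ 2 ∂discMeasure ≤ dirSq h :=
  (integral_norm_sq_eval _).trans_le (dualSq_derivative_le h)

theorem MultBound.integral_derivative_mul_le {f : ℂ[X]} (hf : MultBound f 1) (g : ℂ[X]) :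
    ∫ z, (‖f.derivative.eval z‖ * ‖g.eval z‖) ^ 2 ∂discMeasure ≤ 4 * dirSq g := by
  have h1 : ∫ z, (‖f.derivative.eval z‖ * ‖g.eval z‖) ^ 2 ∂discMeasure ≤
      ∫ z, (2 * ‖(f * g).derivative.eval z‖ ^ 2 + 2 * ‖g.derivative.eval z‖ ^ 2) ∂discMeasure := by
    refine integral_disc_mono (by fun_prop) (by fun_prop) fun z hz => ?_
    have h2 : f.derivative.eval z * g.eval z = (f * g).derivative.eval z -
        f.eval z * g.derivative.eval z := by
      simp [Polynomial.derivative_mul]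
    rw [← norm_mul, h2]
    have h3 := norm_sub_le ((f * g).derivative.eval z) (f.eval z * g.derivative.eval z)
    have h4 : ‖f.eval z * g.derivative.eval z‖ ≤ ‖g.derivative.eval z‖ := by
      rw [norm_mul]
      exact mul_le_of_le_one_left (norm_nonneg _) (hf.norm_eval_le_one (by simpa using hz))
    have h5 := h3.trans (add_le_add le_rfl h4)
    have h6 := pow_le_pow_left₀ (norm_nonneg _) h5 2
    nlinarith [sq_nonneg (‖(f * g).derivative.eval z‖ - ‖g.derivative.eval z‖)]
  rw [integral_add (integrable_disc (by fun_prop)) (integrable_disc (by fun_prop)),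
    integral_const_mul, integral_const_mul] at h1
  have h2 := integral_norm_sq_eval_derivative_le (f * g)
  have h3 := integral_norm_sq_eval_derivative_le g
  have h4 := hf.dirSq_mul_le g
  linarith

section

section Wolff

variable {ι : Type*} [Fintype ι]

/-- The sum of the squared moduli of the `f k`, as a complex number. -/
noncomputable def sumSq (f : ι → ℂ[X]) (z : ℂ) : ℂ :=
  ∑ l, (f l).eval z * (starRingEnd ℂ) ((f l).eval z)

/-- The smooth solution of `∑ k, f k * phi k = A`. -/
noncomputable def phi (f : ι → ℂ[X]) (A : ℂ[X]) (k : ι) (z : ℂ) : ℂ :=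
  A.eval z * (starRingEnd ℂ) ((f k).eval z) * (sumSq f z)⁻¹

/-- The Wirtinger derivative of `phi` in `z`. -/
noncomputable def dphi (f : ι → ℂ[X]) (A : ℂ[X]) (k : ι) (z : ℂ) : ℂ :=
  A.derivative.eval z * (starRingEnd ℂ) ((f k).eval z) * (sumSq f z)⁻¹ -
    A.eval z * (starRingEnd ℂ) ((f k).eval z) *
      (∑ l, (f l).derivative.eval z * (starRingEnd ℂ) ((f l).eval z)) * (sumSq f z)⁻¹ ^ 2

/-- The antisymmetric data of Wolff's `d-bar`-equation. -/
noncomputable def omega (f : ι → ℂ[X]) (A : ℂ[X]) (k l : ι) (z : ℂ) : ℂ :=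
  A.eval z * ((starRingEnd ℂ) ((f l).eval z) * (starRingEnd ℂ) ((f k).derivative.eval z) -
    (starRingEnd ℂ) ((f k).eval z) * (starRingEnd ℂ) ((f l).derivative.eval z)) *
      (sumSq f z)⁻¹ ^ 2

theorem sumSq_eq_ofReal (f : ι → ℂ[X]) (z : ℂ) :
    sumSq f z = ((∑ l, ‖(f l).eval z‖ ^ 2 : ℝ) : ℂ) := by
  simp [sumSq, mul_conj']

theorem continuous_sumSq (f : ι → ℂ[X]) : Continuous (sumSq f) := by
  unfold sumSq
  fun_prop

theorem hasWirt_phi (f : ι → ℂ[X]) (A : ℂ[X]) (k : ι) {z : ℂ} (hz : sumSq f z ≠ 0) :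
    HasWirt (phi f A k) (dphi f A k z) (∑ l, (f l).eval z * omega f A k l z) z := by
  have h1 := (HasWirt.polynomial A z).mul (HasWirt.polynomial (f k) z).conj
  have h2 : HasWirt (sumSq f) _ _ z := HasWirt.sum (s := Finset.univ) fun l _ =>
    (HasWirt.polynomial (f l) z).mul (HasWirt.polynomial (f l) z).conj
  refine (h1.mul (h2.inv hz)).congr ?_ ?_
  · simp only [dphi, map_zero, mul_zero, add_zero, inv_pow]
    field_simp
    ring
  · have h3 : ∑ l, (f l).eval z * omega f A k l z = A.eval z *
        (sumSq f z * (starRingEnd ℂ) ((f k).derivative.eval z) - (starRingEnd ℂ) ((f k).eval z) *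
          ∑ l, (f l).eval z * (starRingEnd ℂ) ((f l).derivative.eval z)) * (sumSq f z)⁻¹ ^ 2 := by
      rw [sumSq, Finset.sum_mul, Finset.mul_sum, ← Finset.sum_sub_distrib, Finset.mul_sum,
        Finset.sum_mul]
      refine Finset.sum_congr rfl fun l _ => ?_
      rw [omega, sumSq]
      ring
    rw [h3]
    simp only [zero_mul, zero_add]
    field_simp
    ring

theorem sum_mul_phi (f : ι → ℂ[X]) (A : ℂ[X]) {z : ℂ} (hz : sumSq f z ≠ 0) :
    ∑ k, (f k).eval z * phi f A k z = A.eval z := by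
  calc ∑ k, (f k).eval z * phi f A k z = sumSq f z * A.eval z * (sumSq f z)⁻¹ := by
        rw [sumSq, Finset.sum_mul, Finset.sum_mul]
        refine Finset.sum_congr rfl fun l _ => ?_
        rw [phi, sumSq]
        ring
    _ = _ := by field_simp

theorem omega_antisymm (f : ι → ℂ[X]) (A : ℂ[X]) (k l : ι) (z : ℂ) :
    omega f A k l z = -omega f A l k z := by
  unfold omega; ring

theorem continuous_conj_eval (p : ℂ[X]) : Continuous fun z => (starRingEnd ℂ) (p.eval z) :=
  continuous_conj.comp p.continuous

theorem continuousOn_inv_sumSq {f : ι → ℂ[X]} (hS : ∀ z ∈ closedBall (0 : ℂ) 1, sumSq f z ≠ 0) :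
    ContinuousOn (fun z => (sumSq f z)⁻¹) (closedBall 0 1) :=
  (continuous_sumSq f).continuousOn.inv₀ hS

theorem continuousOn_phi {f : ι → ℂ[X]} (hS : ∀ z ∈ closedBall (0 : ℂ) 1, sumSq f z ≠ 0)
    (A : ℂ[X]) (k : ι) : ContinuousOn (phi f A k) (closedBall 0 1) :=
  (A.continuous.mul (continuous_conj_eval _)).continuousOn.mul (continuousOn_inv_sumSq hS)

theorem continuousOn_dphi {f : ι → ℂ[X]} (hS : ∀ z ∈ closedBall (0 : ℂ) 1, sumSq f z ≠ 0)
    (A : ℂ[X]) (k : ι) : ContinuousOn (dphi f A k) (closedBall 0 1) :=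
  ((A.derivative.continuous.mul (continuous_conj_eval _)).continuousOn.mul
    (continuousOn_inv_sumSq hS)).sub
  (((A.continuous.mul (continuous_conj_eval _)).mul (continuous_finsetSum _ fun l _ =>
    (f l).derivative.continuous.mul (continuous_conj_eval _))).continuousOn.mul
      ((continuousOn_inv_sumSq hS).pow 2))

theorem continuousOn_omega {f : ι → ℂ[X]} (hS : ∀ z ∈ closedBall (0 : ℂ) 1, sumSq f z ≠ 0)
    (A : ℂ[X]) (k l : ι) : ContinuousOn (omega f A k l) (closedBall 0 1) :=
  (A.continuous.mul (((continuous_conj_eval _).mul (continuous_conj_eval _)).sub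
    ((continuous_conj_eval _).mul (continuous_conj_eval _)))).continuousOn.mul
      ((continuousOn_inv_sumSq hS).pow 2)

end Wolff

end

section

section WolffBounds

variable {ι : Type*} [Fintype ι] {f : ι → ℂ[X]} {H : ℂ[X]} {z : ℂ}

theorem norm_sumSq (f : ι → ℂ[X]) (z : ℂ) : ‖sumSq f z‖ = ∑ l, ‖(f l).eval z‖ ^ 2 := by
  rw [sumSq_eq_ofReal, norm_real, Real.norm_of_nonneg (by positivity)]

theorem norm_eval_sq_le_sumSq (f : ι → ℂ[X]) (z : ℂ) (k : ι) :
    ‖(f k).eval z‖ ^ 2 ≤ ‖sumSq f z‖ := by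
  rw [norm_sumSq]
  exact Finset.single_le_sum (f := fun l => ‖(f l).eval z‖ ^ 2) (fun l _ => by positivity)
    (Finset.mem_univ k)

theorem mul_le_of_sq_le {x y s : ℝ} (hx : x ^ 2 ≤ s) (hy : y ^ 2 ≤ s) : x * y ≤ s := by
  nlinarith [sq_nonneg (x - y)]

theorem norm_phi_le (hS : sumSq f z ≠ 0) (hH : ‖H.eval z‖ ^ 2 ≤ ‖sumSq f z‖)
    (hH1 : ‖H.eval z‖ ≤ 1) (h : ℂ[X]) (k : ι) :
    ‖phi f (H ^ 3 * h) k z‖ ≤ ‖h.eval z‖ := by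
  have hs : 0 < ‖sumSq f z‖ := norm_pos_iff.2 hS
  have h1 := mul_le_of_sq_le hH (norm_eval_sq_le_sumSq f z k)
  rw [phi, norm_mul, norm_inv, ← div_eq_mul_inv, div_le_iff₀ hs]
  simp only [Polynomial.eval_mul, Polynomial.eval_pow, norm_mul, norm_pow, RCLike.norm_conj]
  calc ‖H.eval z‖ ^ 3 * ‖h.eval z‖ * ‖(f k).eval z‖ =
      ‖h.eval z‖ * (‖H.eval z‖ ^ 2 * (‖H.eval z‖ * ‖(f k).eval z‖)) := by ring
    _ ≤ ‖h.eval z‖ * (1 * ‖sumSq f z‖) := by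
        gcongr
        exact pow_le_one₀ (norm_nonneg _) hH1
    _ = _ := by ring

theorem norm_omega_le (hS : sumSq f z ≠ 0) (hH : ‖H.eval z‖ ^ 2 ≤ ‖sumSq f z‖)
    (h : ℂ[X]) (k l : ι) :
    ‖omega f (H ^ 3 * h) k l z‖ ≤
      ‖(f k).derivative.eval z‖ * ‖h.eval z‖ + ‖(f l).derivative.eval z‖ * ‖h.eval z‖ := by
  have hs : 0 < ‖sumSq f z‖ := norm_pos_iff.2 hS
  have h1 := mul_le_of_sq_le hH (norm_eval_sq_le_sumSq f z k)
  have h2 := mul_le_of_sq_le hH (norm_eval_sq_le_sumSq f z l)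
  rw [omega, norm_mul, norm_pow, norm_inv, inv_pow, ← div_eq_mul_inv, div_le_iff₀ (by positivity),
    norm_mul]
  have h3 := norm_sub_le ((starRingEnd ℂ) ((f l).eval z) * (starRingEnd ℂ) ((f k).derivative.eval z))
    ((starRingEnd ℂ) ((f k).eval z) * (starRingEnd ℂ) ((f l).derivative.eval z))
  simp only [norm_mul, RCLike.norm_conj] at h3
  simp only [Polynomial.eval_mul, Polynomial.eval_pow, norm_mul, norm_pow]
  refine (mul_le_mul_of_nonneg_left h3 (by positivity)).trans ?_
  calc _ = ‖h.eval z‖ * (‖(f k).derivative.eval z‖ * (‖H.eval z‖ ^ 2 *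
        (‖H.eval z‖ * ‖(f l).eval z‖)) + ‖(f l).derivative.eval z‖ * (‖H.eval z‖ ^ 2 *
        (‖H.eval z‖ * ‖(f k).eval z‖))) := by ring
    _ ≤ ‖h.eval z‖ * (‖(f k).derivative.eval z‖ * (‖sumSq f z‖ * ‖sumSq f z‖) +
        ‖(f l).derivative.eval z‖ * (‖sumSq f z‖ * ‖sumSq f z‖)) := by gcongr
    _ = _ := by ring

theorem norm_dphi_le (hS : sumSq f z ≠ 0) (hH : ‖H.eval z‖ ^ 2 ≤ ‖sumSq f z‖)
    (hH1 : ‖H.eval z‖ ≤ 1) (h : ℂ[X]) {k : ι} (hf1 : ‖(f k).eval z‖ ≤ 1) :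
    ‖dphi f (H ^ 3 * h) k z‖ ≤ 3 * (‖H.derivative.eval z‖ * ‖h.eval z‖) + ‖h.derivative.eval z‖ +
      ∑ l, ‖(f l).derivative.eval z‖ * ‖h.eval z‖ := by
  have hs : 0 < ‖sumSq f z‖ := norm_pos_iff.2 hS
  have hH2 : ‖H.eval z‖ ^ 2 ≤ 1 := pow_le_one₀ (norm_nonneg _) hH1
  refine (norm_sub_le _ _).trans (add_le_add ?_ ?_)
  · rw [norm_mul, norm_inv, ← div_eq_mul_inv, div_le_iff₀ hs, norm_mul, RCLike.norm_conj]
    have h1 : ‖(H ^ 3 * h).derivative.eval z‖ ≤ ‖sumSq f z‖ *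
        (3 * (‖H.derivative.eval z‖ * ‖h.eval z‖) + ‖h.derivative.eval z‖) := by
      simp only [Polynomial.derivative_mul, Polynomial.derivative_pow, Polynomial.eval_add,
        Polynomial.eval_mul, Polynomial.eval_pow]
      refine (norm_add_le _ _).trans ?_
      simp only [norm_mul, norm_pow]
      norm_num
      calc _ = ‖H.eval z‖ ^ 2 * (3 * (‖H.derivative.eval z‖ * ‖h.eval z‖) +
            ‖H.eval z‖ * ‖h.derivative.eval z‖) := by ring
        _ ≤ ‖sumSq f z‖ * (3 * (‖H.derivative.eval z‖ * ‖h.eval z‖) +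
            1 * ‖h.derivative.eval z‖) := by gcongr
        _ = _ := by ring
    calc _ ≤ ‖sumSq f z‖ * (3 * (‖H.derivative.eval z‖ * ‖h.eval z‖) + ‖h.derivative.eval z‖) *
          1 := by gcongr
      _ = _ := by ring
  · rw [norm_mul, norm_pow, norm_inv, inv_pow, ← div_eq_mul_inv, div_le_iff₀ (by positivity),
      norm_mul, norm_mul, RCLike.norm_conj, Polynomial.eval_mul, Polynomial.eval_pow, norm_mul,
      norm_pow, Finset.sum_mul]
    have h1 := norm_sum_le (Finset.univ : Finset ι) fun l =>
      (f l).derivative.eval z * (starRingEnd ℂ) ((f l).eval z)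
    refine (mul_le_mul_of_nonneg_left h1 (by positivity)).trans ?_
    rw [Finset.mul_sum]
    refine Finset.sum_le_sum fun l _ => ?_
    rw [norm_mul, RCLike.norm_conj]
    have h2 := mul_le_of_sq_le (norm_eval_sq_le_sumSq f z k) (norm_eval_sq_le_sumSq f z l)
    calc _ = ‖(f l).derivative.eval z‖ * ‖h.eval z‖ * ((‖H.eval z‖ ^ 2 * ‖H.eval z‖) *
          (‖(f k).eval z‖ * ‖(f l).eval z‖)) := by ring
      _ ≤ ‖(f l).derivative.eval z‖ * ‖h.eval z‖ * ((‖sumSq f z‖ * 1) * ‖sumSq f z‖) := by gcongr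
      _ = _ := by ring

theorem integral_norm_sq_omega_le (hf : ∀ k, MultBound (f k) 1)
    (hS : ∀ z ∈ closedBall (0 : ℂ) 1, sumSq f z ≠ 0)
    (hH : ∀ z ∈ closedBall (0 : ℂ) 1, ‖H.eval z‖ ^ 2 ≤ ‖sumSq f z‖) (h : ℂ[X]) (k l : ι) :
    ∫ z, ‖omega f (H ^ 3 * h) k l z‖ ^ 2 ∂discMeasure ≤ 16 * dirSq h := by
  have h1 : ∫ z, ‖omega f (H ^ 3 * h) k l z‖ ^ 2 ∂discMeasure ≤
      ∫ z, (2 * (‖(f k).derivative.eval z‖ * ‖h.eval z‖) ^ 2 +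
        2 * (‖(f l).derivative.eval z‖ * ‖h.eval z‖) ^ 2) ∂discMeasure := by
    refine integral_disc_mono ((continuousOn_omega hS _ _ _).norm.pow 2) (by fun_prop) fun z hz => ?_
    have h2 := pow_le_pow_left₀ (norm_nonneg _) (norm_omega_le (hS z hz) (hH z hz) h k l) 2
    nlinarith [sq_nonneg (‖(f k).derivative.eval z‖ * ‖h.eval z‖ -
      ‖(f l).derivative.eval z‖ * ‖h.eval z‖)]
  rw [integral_add (integrable_disc (by fun_prop)) (integrable_disc (by fun_prop)),
    integral_const_mul, integral_const_mul] at h1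
  have h2 := (hf k).integral_derivative_mul_le h
  have h3 := (hf l).integral_derivative_mul_le h
  linarith

end WolffBounds

end

section

section WolffSolution

variable {ι : Type*} [Fintype ι]

/-- The polynomial whose conjugate corrects `omega` to be orthogonal to low powers. -/
noncomputable def corr (f : ι → ℂ[X]) (A : ℂ[X]) (K : ℕ) (k l : ι) : ℂ[X] :=
  ∑ i ∈ Finset.range K, Polynomial.monomial (i + 1)
    ((starRingEnd ℂ) (∫ z, omega f A k l z * z ^ i ∂discMeasure))

theorem coeff_corr_succ (f : ι → ℂ[X]) (A : ℂ[X]) (K : ℕ) (k l : ι) (i : ℕ) :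
    (corr f A K k l).coeff (i + 1) =
      if i < K then (starRingEnd ℂ) (∫ z, omega f A k l z * z ^ i ∂discMeasure) else 0 := by
  simp [corr, Polynomial.finsetSum_coeff, Polynomial.coeff_monomial]

theorem coeff_corr_zero (f : ι → ℂ[X]) (A : ℂ[X]) (K : ℕ) (k l : ι) :
    (corr f A K k l).coeff 0 = 0 := by
  simp [corr, Polynomial.finsetSum_coeff, Polynomial.coeff_monomial]

theorem corr_antisymm (f : ι → ℂ[X]) (A : ℂ[X]) (K : ℕ) (k l : ι) :
    corr f A K k l = -corr f A K l k := by
  rw [corr, corr, ← Finset.sum_neg_distrib]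
  refine Finset.sum_congr rfl fun i _ => ?_
  rw [← Polynomial.monomial_neg, ← map_neg, ← integral_neg]
  simp only [omega_antisymm f A k l, neg_mul]

theorem natDegree_corr_lt (f : ι → ℂ[X]) (A : ℂ[X]) (K : ℕ) (k l : ι) :
    (corr f A K k l).natDegree < K + 1 := by
  refine Nat.lt_succ_of_le (Polynomial.natDegree_le_iff_coeff_eq_zero.2 fun m hm => ?_)
  obtain ⟨m, rfl⟩ : ∃ i, m = i + 1 := ⟨m - 1, by omega⟩
  rw [coeff_corr_succ, if_neg (by omega)]

theorem dirSq_corr_le {f : ι → ℂ[X]} (hS : ∀ z ∈ closedBall (0 : ℂ) 1, sumSq f z ≠ 0)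
    (A : ℂ[X]) (K : ℕ) (k l : ι) :
    dirSq (corr f A K k l) ≤ 2 * ∫ z, ‖omega f A k l z‖ ^ 2 ∂discMeasure := by
  have h := sum_norm_sq_integral_le (continuous_conj.comp_continuousOn (continuousOn_omega hS A k l)) K
  have h2 : ∀ m : ℕ, ‖∫ z, (starRingEnd ℂ) (omega f A k l z) * (starRingEnd ℂ) z ^ m ∂discMeasure‖ =
      ‖∫ z, omega f A k l z * z ^ m ∂discMeasure‖ := by
    intro m
    simp only [← map_pow, ← map_mul]
    rw [integral_disc_conj, RCLike.norm_conj]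
  simp only [h2, RCLike.norm_conj, Function.comp_apply] at h
  refine le_trans ?_ (mul_le_mul_of_nonneg_left h zero_le_two)
  rw [dirSq_eq_sum _ (support_subset_range (natDegree_corr_lt f A K k l)),
    Finset.sum_range_succ' _ K, coeff_corr_zero, norm_zero, Finset.mul_sum]
  simp only [zero_pow two_ne_zero, mul_zero, add_zero]
  refine Finset.sum_le_sum fun i hi => ?_
  rw [coeff_corr_succ, if_pos (Finset.mem_range.1 hi), RCLike.norm_conj, ← mul_assoc]
  gcongr
  push_cast
  linarith [(Nat.cast_nonneg i : (0 : ℝ) ≤ i)]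

theorem integral_omega_sub_mul_pow {f : ι → ℂ[X]}
    (hS : ∀ z ∈ closedBall (0 : ℂ) 1, sumSq f z ≠ 0) (A : ℂ[X]) {K j : ℕ} (k l : ι) (hj : j < K) :
    ∫ z, (omega f A k l z - (starRingEnd ℂ) ((corr f A K k l).derivative.eval z)) * z ^ j
      ∂discMeasure = 0 := by
  have h := integral_disc_conj fun z =>
    (corr f A K k l).derivative.eval z * (starRingEnd ℂ) z ^ j
  rw [integral_eval_mul_conj_pow, Polynomial.coeff_derivative, coeff_corr_succ, if_pos hj,
    mul_div_cancel_right₀ _ (by exact_mod_cast j.succ_ne_zero), conj_conj] at h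
  simp only [map_mul, map_pow, conj_conj] at h
  have h1 : ContinuousOn (fun z => omega f A k l z * z ^ j) (closedBall 0 1) :=
    (continuousOn_omega hS A k l).mul (by fun_prop)
  have h2 : Continuous fun z =>
      (starRingEnd ℂ) ((corr f A K k l).derivative.eval z) * z ^ j :=
    (continuous_conj_eval _).mul (by fun_prop)
  simp only [sub_mul]
  rw [integral_sub (integrable_disc h1) (integrable_disc h2.continuousOn), h, sub_self]

/-- The solution of `∑ k, f k * sol k = A` whose low order `d-bar`-moments vanish. -/
noncomputable def sol (f : ι → ℂ[X]) (A : ℂ[X]) (K : ℕ) (k : ι) (z : ℂ) : ℂ :=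
  phi f A k z - ∑ l, (f l).eval z * (starRingEnd ℂ) ((corr f A K k l).eval z)

theorem hasWirt_sol (f : ι → ℂ[X]) (A : ℂ[X]) (K : ℕ) (k : ι) {z : ℂ} (hz : sumSq f z ≠ 0) :
    HasWirt (sol f A K k)
      (dphi f A k z -
        ∑ l, (f l).derivative.eval z * (starRingEnd ℂ) ((corr f A K k l).eval z))
      (∑ l, (f l).eval z *
        (omega f A k l z - (starRingEnd ℂ) ((corr f A K k l).derivative.eval z))) z := by
  refine ((hasWirt_phi f A k hz).sub (HasWirt.sum (s := Finset.univ) fun l _ =>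
    (HasWirt.polynomial (f l) z).mul (HasWirt.polynomial (corr f A K k l) z).conj)).congr ?_ ?_
  · simp
  · simp [mul_sub]

theorem sum_mul_sol (f : ι → ℂ[X]) (A : ℂ[X]) (K : ℕ) {z : ℂ} (hz : sumSq f z ≠ 0) :
    ∑ k, (f k).eval z * sol f A K k z = A.eval z := by
  have h1 : ∑ k, ∑ l, (f k).eval z * ((f l).eval z *
      (starRingEnd ℂ) ((corr f A K k l).eval z)) = 0 := by
    have h2 : ∑ k, ∑ l, (f k).eval z * ((f l).eval z *
        (starRingEnd ℂ) ((corr f A K k l).eval z)) = -∑ k, ∑ l, (f k).eval z * ((f l).eval z *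
          (starRingEnd ℂ) ((corr f A K k l).eval z)) := by
      conv_rhs => rw [Finset.sum_comm]
      rw [← Finset.sum_neg_distrib]
      refine Finset.sum_congr rfl fun k _ => ?_
      rw [← Finset.sum_neg_distrib]
      refine Finset.sum_congr rfl fun l _ => ?_
      rw [corr_antisymm f A K k l, Polynomial.eval_neg, map_neg]
      ring
    exact self_eq_neg.1 h2
  simp only [sol, mul_sub, Finset.sum_sub_distrib, Finset.mul_sum]
  rw [sum_mul_phi f A hz, h1, sub_zero]

theorem continuousOn_sol {f : ι → ℂ[X]} (hS : ∀ z ∈ closedBall (0 : ℂ) 1, sumSq f z ≠ 0)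
    (A : ℂ[X]) (K : ℕ) (k : ι) : ContinuousOn (sol f A K k) (closedBall 0 1) :=
  (continuousOn_phi hS A k).sub (continuous_finsetSum _ fun l _ =>
    (f l).continuous.mul (continuous_conj_eval _)).continuousOn

theorem circleAverage_sol_mul_pow {f : ι → ℂ[X]}
    (hS : ∀ z ∈ closedBall (0 : ℂ) 1, sumSq f z ≠ 0) (A : ℂ[X]) {K m : ℕ} (k : ι)
    (hm : ∀ l, (f l).natDegree + m < K) :
    Real.circleAverage (fun z => sol f A K k z * z ^ (m + 1)) 0 1 = 0 := by
  set ρ : ι → ℂ → ℂ := fun l z =>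
    omega f A k l z - (starRingEnd ℂ) ((corr f A K k l).derivative.eval z) with hρ
  have hcont : ∀ l, ContinuousOn (ρ l) (closedBall 0 1) := fun l =>
    (continuousOn_omega hS A k l).sub (continuous_conj_eval _).continuousOn
  have hcont2 : ∀ l (j : ℕ), ContinuousOn (fun z => (f l).coeff j * (ρ l z * z ^ (j + m)))
      (closedBall 0 1) := fun l j => continuousOn_const.mul ((hcont l).mul (by fun_prop))
  have h := circleAverage_mul_eq_integral (G := fun z => sol f A K k z * z ^ m)
    (b := fun z => ∑ l, ∑ j ∈ Finset.range ((f l).natDegree + 1),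
      (f l).coeff j * (ρ l z * z ^ (j + m)))
    (fun z hz => ((hasWirt_sol f A K k (hS z hz)).mul
      (HasWirt.of_hasDerivAt (hasDerivAt_pow m z))).congr rfl (by
        rw [mul_zero, add_zero, Finset.sum_mul]
        refine Finset.sum_congr rfl fun l _ => ?_
        rw [Polynomial.eval_eq_sum_range, Finset.sum_mul, Finset.sum_mul]
        refine Finset.sum_congr rfl fun j _ => ?_
        rw [hρ]
        ring))
    (continuousOn_finsetSum _ fun l _ => continuousOn_finsetSum _ fun j _ => hcont2 l j)
  have h2 : (fun z => sol f A K k z * z ^ (m + 1)) = fun z => z * (sol f A K k z * z ^ m) := by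
    ext z; ring
  rw [h2, h, integral_finsetSum _ fun l _ => integrable_disc (continuousOn_finsetSum _ fun j _ =>
    hcont2 l j)]
  refine Finset.sum_eq_zero fun l _ => ?_
  rw [integral_finsetSum _ fun j _ => integrable_disc (hcont2 l j)]
  refine Finset.sum_eq_zero fun j hj => ?_
  have := hm l
  have := Finset.mem_range.1 hj
  rw [integral_const_mul, integral_omega_sub_mul_pow hS A k l (by omega), mul_zero]

/-- The Wirtinger derivative of `z * sol z` in `z`. -/
noncomputable def dzsol (f : ι → ℂ[X]) (A : ℂ[X]) (K : ℕ) (k : ι) (z : ℂ) : ℂ :=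
  sol f A K k z + z * (dphi f A k z -
    ∑ l, (f l).derivative.eval z * (starRingEnd ℂ) ((corr f A K k l).eval z))

theorem continuousOn_dzsol {f : ι → ℂ[X]} (hS : ∀ z ∈ closedBall (0 : ℂ) 1, sumSq f z ≠ 0)
    (A : ℂ[X]) (K : ℕ) (k : ι) : ContinuousOn (dzsol f A K k) (closedBall 0 1) :=
  (continuousOn_sol hS A K k).add (continuousOn_id.mul ((continuousOn_dphi hS A k).sub
    (continuous_finsetSum _ fun l _ =>
      (f l).derivative.continuous.mul (continuous_conj_eval _)).continuousOn))

theorem circleAverage_sol_mul_conj_pow {f : ι → ℂ[X]}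
    (hS : ∀ z ∈ closedBall (0 : ℂ) 1, sumSq f z ≠ 0) (A : ℂ[X]) (K m : ℕ) (k : ι) :
    Real.circleAverage (fun z => sol f A K k z * (starRingEnd ℂ) z ^ m) 0 1 =
      ∫ z, dzsol f A K k z * (starRingEnd ℂ) z ^ m ∂discMeasure := by
  have hcont : ContinuousOn (fun z => dzsol f A K k z * (starRingEnd ℂ) z ^ m) (closedBall 0 1) :=
    (continuousOn_dzsol hS A K k).mul (by fun_prop)
  rw [← circleAverage_conj_mul_eq_integral (G := fun z => z * sol f A K k z * (starRingEnd ℂ) z ^ m)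
    (fun z hz => by
      have h := ((HasWirt.of_hasDerivAt (hasDerivAt_id' z)).mul
        (hasWirt_sol f A K k (hS z hz))).mul (HasWirt.of_hasDerivAt (hasDerivAt_pow m z)).conj
      simp only [map_pow] at h
      refine h.congr ?_ rfl
      rw [dzsol]
      simp)
    hcont]
  refine Real.circleAverage_congr_sphere fun z hz => ?_
  have h := conj_mul_of_mem_sphere hz
  calc sol f A K k z * (starRingEnd ℂ) z ^ m =
      1 * (sol f A K k z * (starRingEnd ℂ) z ^ m) := by ring
    _ = _ := by rw [← h]; ring

/-- The analytic part of `sol` on the unit circle. -/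
noncomputable def solSeries (f : ι → ℂ[X]) (A : ℂ[X]) (K : ℕ) (k : ι) : ℂ⟦X⟧ :=
  PowerSeries.mk fun m => Real.circleAverage (fun z => sol f A K k z * (starRingEnd ℂ) z ^ m) 0 1

theorem sum_norm_sq_solSeries_le {f : ι → ℂ[X]}
    (hS : ∀ z ∈ closedBall (0 : ℂ) 1, sumSq f z ≠ 0) (A : ℂ[X]) (K N : ℕ) (k : ι) :
    ∑ m ∈ Finset.range N, ((m : ℝ) + 1) * ‖coeff m (solSeries f A K k)‖ ^ 2 ≤
      ∫ z, ‖dzsol f A K k z‖ ^ 2 ∂discMeasure := by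
  simp only [solSeries, PowerSeries.coeff_mk, circleAverage_sol_mul_conj_pow hS]
  exact sum_norm_sq_integral_le (continuousOn_dzsol hS A K k) N

theorem circleAverage_eval_mul_conj_pow (A : ℂ[X]) (s : ℕ) :
    Real.circleAverage (fun z => A.eval z * (starRingEnd ℂ) z ^ s) 0 1 = A.coeff s := by
  have h : (fun z => A.eval z * (starRingEnd ℂ) z ^ s) = fun z =>
      ∑ i ∈ Finset.range (A.natDegree + 1 + s), A.coeff i • (z ^ i * (starRingEnd ℂ) z ^ s) := by
    ext z
    rw [Polynomial.eval_eq_sum_range' (n := A.natDegree + 1 + s) (by omega), Finset.sum_mul]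
    exact Finset.sum_congr rfl fun j _ => by rw [smul_eq_mul]; ring
  have hc : ∀ (i : ℕ) (c : ℂ), Continuous fun z => c • (z ^ i * (starRingEnd ℂ) z ^ s) :=
    fun i c => by fun_prop
  rw [h, Real.circleAverage_fun_sum fun i _ => (hc i _).continuousOn.circleIntegrable zero_le_one]
  simp only [Real.circleAverage_fun_smul, circleAverage_pow_mul_conj_pow]
  by_cases hs : s < A.natDegree + 1 + s
  · simp [hs]
  · omega

theorem eq_sum_mul_solSeries {f : ι → ℂ[X]}
    (hS : ∀ z ∈ closedBall (0 : ℂ) 1, sumSq f z ≠ 0) (A : ℂ[X]) {K d : ℕ}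
    (hd : ∀ l, (f l).natDegree ≤ d) (hK : 2 * d < K) :
    (A : ℂ⟦X⟧) = ∑ k, (f k : ℂ⟦X⟧) * solSeries f A K k := by
  ext s
  have hint : ∀ (k : ι) (j : ℕ), CircleIntegrable
      (fun z => (f k).coeff j • (sol f A K k z * z ^ j * (starRingEnd ℂ) z ^ s)) 0 1 := fun k j =>
    ContinuousOn.circleIntegrable zero_le_one (continuousOn_const.mul
      ((((continuousOn_sol hS A K k).mono sphere_subset_closedBall).mul (by fun_prop)).mul
        (by fun_prop)))
  have h2 : ∀ z ∈ sphere (0 : ℂ) |1|, A.eval z * (starRingEnd ℂ) z ^ s =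
      ∑ k, ∑ j ∈ Finset.range (d + 1 + s), (f k).coeff j •
        (sol f A K k z * z ^ j * (starRingEnd ℂ) z ^ s) := by
    intro z hz
    rw [abs_one] at hz
    rw [← sum_mul_sol f A K (hS z (sphere_subset_closedBall hz)), Finset.sum_mul]
    refine Finset.sum_congr rfl fun k _ => ?_
    rw [Polynomial.eval_eq_sum_range' (n := d + 1 + s) (by have := hd k; omega), Finset.sum_mul,
      Finset.sum_mul]
    exact Finset.sum_congr rfl fun j _ => by rw [smul_eq_mul]; ring
  have hle : ∀ (k : ι) (j : ℕ), j ≤ s → Real.circleAverage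
      (fun z => sol f A K k z * z ^ j * (starRingEnd ℂ) z ^ s) 0 1 =
        Real.circleAverage (fun z => sol f A K k z * (starRingEnd ℂ) z ^ (s - j)) 0 1 := by
    intro k j hj
    refine Real.circleAverage_congr_sphere fun z hz => ?_
    have h := conj_mul_of_mem_sphere hz
    obtain ⟨t, rfl⟩ := Nat.exists_eq_add_of_le hj
    rw [Nat.add_sub_cancel_left]
    calc _ = sol f A K k z * (starRingEnd ℂ) z ^ t * ((starRingEnd ℂ) z * z) ^ j := by ring
      _ = _ := by rw [h, one_pow, mul_one]
  have hgt : ∀ (k : ι) (j : ℕ), s < j → j ≤ d → Real.circleAverage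
      (fun z => sol f A K k z * z ^ j * (starRingEnd ℂ) z ^ s) 0 1 = 0 := by
    intro k j hj hjd
    obtain ⟨t, rfl⟩ := Nat.exists_eq_add_of_lt hj
    refine (Real.circleAverage_congr_sphere fun z hz => ?_).trans
      (circleAverage_sol_mul_pow (K := K) hS A k (m := t) fun l => by have := hd l; omega)
    have h := conj_mul_of_mem_sphere hz
    calc _ = sol f A K k z * z ^ (t + 1) * ((starRingEnd ℂ) z * z) ^ s := by ring
      _ = _ := by rw [h, one_pow, mul_one]
  rw [Polynomial.coeff_coe, ← circleAverage_eval_mul_conj_pow,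
    Real.circleAverage_congr_sphere h2, Real.circleAverage_fun_sum fun k _ =>
      CircleIntegrable.fun_sum _ fun j _ => hint k j, map_sum]
  refine Finset.sum_congr rfl fun k _ => ?_
  rw [Real.circleAverage_fun_sum fun j _ => hint k j, PowerSeries.coeff_mul,
    Finset.Nat.sum_antidiagonal_eq_sum_range_succ
      (fun i j => coeff i (f k : ℂ⟦X⟧) * coeff j (solSeries f A K k))]
  refine (Finset.sum_subset (Finset.range_subset_range.2 (by omega)) fun j _ hj => ?_).symm.trans
    (Finset.sum_congr rfl fun j hj => ?_)
  · rw [Real.circleAverage_fun_smul]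
    have hj : s < j := by simpa using hj
    by_cases hjd : j ≤ d
    · rw [hgt k j hj hjd, smul_zero]
    · have := hd k
      rw [Polynomial.coeff_eq_zero_of_natDegree_lt (by omega), zero_smul]
  · rw [Real.circleAverage_fun_smul, hle k j (Nat.lt_succ_iff.1 (Finset.mem_range.1 hj)),
      smul_eq_mul, Polynomial.coeff_coe, solSeries, PowerSeries.coeff_mk]

end WolffSolution

end

section

section WolffDual

variable {ι : Type*} [Fintype ι] {f : ι → ℂ[X]} {H : ℂ[X]}

/-- The constant in the energy estimate for `dzsol` with `n` generators. -/
def wolffConst (n : ℕ) : ℝ := 6 * (38 + 164 * (n : ℝ) ^ 2)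

theorem norm_dzsol_le (hf : ∀ k, MultBound (f k) 1) (hH1 : MultBound H 1) {z : ℂ}
    (hz : z ∈ closedBall (0 : ℂ) 1) (hS : sumSq f z ≠ 0)
    (hH : ‖H.eval z‖ ^ 2 ≤ ‖sumSq f z‖) (h : ℂ[X]) (K : ℕ) (k : ι) :
    ‖dzsol f (H ^ 3 * h) K k z‖ ≤ ‖h.eval z‖ + 3 * (‖H.derivative.eval z‖ * ‖h.eval z‖) +
      ‖h.derivative.eval z‖ + ∑ l, ‖(f l).derivative.eval z‖ * ‖h.eval z‖ +
      ∑ l, ‖(corr f (H ^ 3 * h) K k l).eval z‖ +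
      ∑ l, ‖(f l).derivative.eval z‖ * ‖(corr f (H ^ 3 * h) K k l).eval z‖ := by
  have hz1 : ‖z‖ ≤ 1 := by simpa using hz
  have h1 := norm_phi_le hS hH (hH1.norm_eval_le_one hz1) h k
  have h2 := norm_dphi_le hS hH (hH1.norm_eval_le_one hz1) h ((hf k).norm_eval_le_one hz1)
  have h3 : ‖sol f (H ^ 3 * h) K k z‖ ≤
      ‖h.eval z‖ + ∑ l, ‖(corr f (H ^ 3 * h) K k l).eval z‖ := by
    refine (norm_sub_le _ _).trans (add_le_add h1 ((norm_sum_le _ _).trans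
      (Finset.sum_le_sum fun l _ => ?_)))
    rw [norm_mul, RCLike.norm_conj]
    exact mul_le_of_le_one_left (norm_nonneg _) ((hf l).norm_eval_le_one hz1)
  have h4 : ‖∑ l, (f l).derivative.eval z *
      (starRingEnd ℂ) ((corr f (H ^ 3 * h) K k l).eval z)‖ ≤
      ∑ l, ‖(f l).derivative.eval z‖ * ‖(corr f (H ^ 3 * h) K k l).eval z‖ := by
    refine (norm_sum_le _ _).trans_eq (Finset.sum_congr rfl fun l _ => ?_)
    rw [norm_mul, RCLike.norm_conj]
  have h5 : ‖dzsol f (H ^ 3 * h) K k z‖ ≤ ‖sol f (H ^ 3 * h) K k z‖ +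
      (‖dphi f (H ^ 3 * h) k z‖ + ‖∑ l, (f l).derivative.eval z *
      (starRingEnd ℂ) ((corr f (H ^ 3 * h) K k l).eval z)‖) := by
    refine (norm_add_le _ _).trans (add_le_add le_rfl ?_)
    rw [norm_mul]
    exact (mul_le_of_le_one_left (norm_nonneg _) hz1).trans (norm_sub_le _ _)
  linarith

theorem sq_sum_six_le (a b c x y w : ℝ) : (a + b + c + x + y + w) ^ 2 ≤
    6 * (a ^ 2 + b ^ 2 + c ^ 2 + x ^ 2 + y ^ 2 + w ^ 2) := by
  have h := sq_sum_le_card_mul_sum_sq (s := (Finset.univ : Finset (Fin 6))) (f := ![a, b, c, x, y, w])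
  simpa [Fin.sum_univ_succ, add_assoc] using h

theorem integral_norm_sq_dzsol_le (hf : ∀ k, MultBound (f k) 1) (hH1 : MultBound H 1)
    (hS : ∀ z ∈ closedBall (0 : ℂ) 1, sumSq f z ≠ 0)
    (hH : ∀ z ∈ closedBall (0 : ℂ) 1, ‖H.eval z‖ ^ 2 ≤ ‖sumSq f z‖) (h : ℂ[X]) (K : ℕ) (k : ι) :
    ∫ z, ‖dzsol f (H ^ 3 * h) K k z‖ ^ 2 ∂discMeasure ≤
      wolffConst (Fintype.card ι) * dirSq h := by
  set n : ℝ := (Fintype.card ι : ℝ)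
  have h1 : ∫ z, ‖dzsol f (H ^ 3 * h) K k z‖ ^ 2 ∂discMeasure ≤
      ∫ z, 6 * (‖h.eval z‖ ^ 2 + 9 * (‖H.derivative.eval z‖ * ‖h.eval z‖) ^ 2 +
        ‖h.derivative.eval z‖ ^ 2 + n * ∑ l, (‖(f l).derivative.eval z‖ * ‖h.eval z‖) ^ 2 +
        n * ∑ l, ‖(corr f (H ^ 3 * h) K k l).eval z‖ ^ 2 +
        n * ∑ l, (‖(f l).derivative.eval z‖ * ‖(corr f (H ^ 3 * h) K k l).eval z‖) ^ 2)
        ∂discMeasure := by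
    refine integral_disc_mono ((continuousOn_dzsol hS _ _ _).norm.pow 2) (by fun_prop) fun z hz => ?_
    refine (pow_le_pow_left₀ (norm_nonneg _)
      (norm_dzsol_le hf hH1 hz (hS z hz) (hH z hz) h K k) 2).trans ?_
    refine (sq_sum_six_le _ _ _ _ _ _).trans ?_
    have hsum : ∀ g : ι → ℝ, (∑ l, g l) ^ 2 ≤ n * ∑ l, g l ^ 2 := fun g =>
      sq_sum_le_card_mul_sum_sq
    have e1 := hsum fun l => ‖(f l).derivative.eval z‖ * ‖h.eval z‖
    have e2 := hsum fun l => ‖(corr f (H ^ 3 * h) K k l).eval z‖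
    have e3 := hsum fun l => ‖(f l).derivative.eval z‖ * ‖(corr f (H ^ 3 * h) K k l).eval z‖
    rw [mul_pow 3 _ 2]
    linarith
  have hc : ∀ l, dirSq (corr f (H ^ 3 * h) K k l) ≤ 32 * dirSq h := fun l => by
    have e1 := dirSq_corr_le hS (H ^ 3 * h) K k l
    have e2 := integral_norm_sq_omega_le hf hS hH h k l
    linarith
  refine h1.trans ?_
  rw [integral_const_mul, integral_add (integrable_disc (by fun_prop)) (integrable_disc (by fun_prop)),
    integral_add (integrable_disc (by fun_prop)) (integrable_disc (by fun_prop)),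
    integral_add (integrable_disc (by fun_prop)) (integrable_disc (by fun_prop)),
    integral_add (integrable_disc (by fun_prop)) (integrable_disc (by fun_prop)),
    integral_add (integrable_disc (by fun_prop)) (integrable_disc (by fun_prop)),
    integral_const_mul, integral_const_mul, integral_const_mul, integral_const_mul,
    integral_finsetSum _ fun l _ => integrable_disc (by fun_prop),
    integral_finsetSum _ fun l _ => integrable_disc (by fun_prop),
    integral_finsetSum _ fun l _ => integrable_disc (by fun_prop)]
  have hsum : ∀ (g : ι → ℝ) (c : ℝ), (∀ l, g l ≤ c) → n * ∑ l, g l ≤ n * (n * c) := by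
    intro g c hg
    refine mul_le_mul_of_nonneg_left ?_ (by positivity)
    simpa using Finset.sum_le_sum fun l (_ : l ∈ (Finset.univ : Finset ι)) => hg l
  have e1 := integral_norm_sq_eval_le h
  have e2 := hH1.integral_derivative_mul_le h
  have e3 := integral_norm_sq_eval_derivative_le h
  have e4 := hsum _ _ fun l => (hf l).integral_derivative_mul_le h
  have e5 := hsum _ _ fun l => (integral_norm_sq_eval_le (corr f (H ^ 3 * h) K k l)).trans (hc l)
  have e6 := hsum _ _ fun l => ((hf l).integral_derivative_mul_le
    (corr f (H ^ 3 * h) K k l)).trans (mul_le_mul_of_nonneg_left (hc l) (by norm_num))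
  rw [wolffConst]
  linarith

/-- The polynomial norming `q` under `pair`. -/
noncomputable def dualNormer (q : ℂ[X]) : ℂ[X] :=
  ∑ i ∈ q.support, Polynomial.monomial i ((starRingEnd ℂ) (q.coeff i) / ((i : ℂ) + 1))

theorem coeff_dualNormer (q : ℂ[X]) (i : ℕ) :
    (dualNormer q).coeff i = (starRingEnd ℂ) (q.coeff i) / ((i : ℂ) + 1) := by
  simp only [dualNormer, Polynomial.finsetSum_coeff, Polynomial.coeff_monomial, Finset.sum_ite_eq']
  split_ifs with h
  · rfl
  · simp [Polynomial.notMem_support_iff.1 h]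

theorem dirSq_dualNormer (q : ℂ[X]) : dirSq (dualNormer q) = dualSq q := by
  have hs : (dualNormer q).support ⊆ q.support := fun i hi => by
    rw [Polynomial.mem_support_iff, coeff_dualNormer] at hi
    rw [Polynomial.mem_support_iff]
    rintro h
    simp [h] at hi
  rw [dirSq_eq_sum _ hs, dualSq]
  refine Finset.sum_congr rfl fun i _ => ?_
  rw [coeff_dualNormer, norm_div, RCLike.norm_conj, norm_natCast_add_one]
  have : (i : ℝ) + 1 ≠ 0 := by positivity
  field_simp

theorem pair_dualNormer (q : ℂ[X]) : pair (dualNormer q) q = (dualSq q : ℝ) := by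
  rw [pair_eq_sum _ _ subset_rfl, dualSq]
  push_cast
  refine Finset.sum_congr rfl fun i _ => ?_
  rw [coeff_dualNormer, ← conj_mul']
  ring

theorem le_of_le_sqrt_mul {X C n Y Z : ℝ} (hX : 0 ≤ X) (hC : 0 ≤ C)
    (h1 : X ≤ √(C * X) * Y) (h2 : Y ^ 2 ≤ n * Z) : X ≤ C * n * Z := by
  have h3 : X * X ≤ C * n * Z * X := by
    calc X * X = X ^ 2 := by ring
      _ ≤ (√(C * X) * Y) ^ 2 := pow_le_pow_left₀ hX h1 2
      _ = C * X * Y ^ 2 := by rw [mul_pow, Real.sq_sqrt (by positivity)]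
      _ ≤ C * X * (n * Z) := by gcongr
      _ = _ := by ring
  rcases hX.eq_or_lt with h0 | h0
  · rw [← h0, mul_assoc]
    exact mul_nonneg hC ((sq_nonneg Y).trans h2)
  · exact le_of_mul_le_mul_right h3 h0

theorem dualSq_transMul_pow_three_le (hf : ∀ k, MultBound (f k) 1) (hH1 : MultBound H 1)
    (hS : ∀ z ∈ closedBall (0 : ℂ) 1, sumSq f z ≠ 0)
    (hH : ∀ z ∈ closedBall (0 : ℂ) 1, ‖H.eval z‖ ^ 2 ≤ ‖sumSq f z‖) (q : ℂ[X]) :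
    dualSq (transMul ((H : ℂ⟦X⟧) ^ 3) q) ≤
      wolffConst (Fintype.card ι) * Fintype.card ι * ∑ k, dualSq (transMul (f k) q) := by
  set n := Fintype.card ι
  set X := dualSq (transMul ((H : ℂ⟦X⟧) ^ 3) q) with hX
  set D : ι → ℝ := fun k => dualSq (transMul (f k) q) with hD
  have hC : 0 ≤ wolffConst n := by unfold wolffConst; positivity
  have hX0 : 0 ≤ X := dualSq_nonneg _
  set h := dualNormer (transMul ((H : ℂ⟦X⟧) ^ 3) q) with hh
  obtain ⟨d, hd⟩ : ∃ d, ∀ l, (f l).natDegree ≤ d :=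
    ⟨Finset.univ.sup fun l => (f l).natDegree, fun l =>
      Finset.le_sup (f := fun l => (f l).natDegree) (Finset.mem_univ l)⟩
  have h1 := eq_sum_mul_solSeries hS (H ^ 3 * h) (K := 2 * d + 1) hd
    (Nat.lt_succ_self _)
  set u := solSeries f (H ^ 3 * h) (2 * d + 1)
  have h2 : (X : ℂ) = ∑ k, pair (u k) (transMul (f k) q) := by
    rw [hX, ← pair_dualNormer, pair_transMul]
    rw [Polynomial.coe_mul, Polynomial.coe_pow] at h1
    rw [h1]
    simp only [pair_transMul, pair_eq_sum _ _ (Finset.Subset.refl q.support), map_sum,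
      Finset.sum_mul]
    exact Finset.sum_comm
  have h3 : ∀ k, ‖pair (u k) (transMul (f k) q)‖ ≤ √(wolffConst n * X) * √(D k) := by
    intro k
    refine (norm_pair_le (u k) _ (Nat.lt_succ_self _)).trans ?_
    gcongr
    refine (sum_norm_sq_solSeries_le hS _ _ _ k).trans ?_
    refine (integral_norm_sq_dzsol_le hf hH1 hS hH h _ k).trans_eq ?_
    rw [hh, dirSq_dualNormer]
  have h4 : X ≤ √(wolffConst n * X) * ∑ k, √(D k) := by
    calc X = ‖(X : ℂ)‖ := by rw [norm_real, Real.norm_of_nonneg hX0]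
      _ ≤ ∑ k, ‖pair (u k) (transMul (f k) q)‖ := by rw [h2]; exact norm_sum_le _ _
      _ ≤ ∑ k, √(wolffConst n * X) * √(D k) := Finset.sum_le_sum fun k _ => h3 k
      _ = _ := by rw [Finset.mul_sum]
  have h5 : (∑ k, √(D k)) ^ 2 ≤ n * ∑ k, D k := by
    have e := sq_sum_le_card_mul_sum_sq (s := (Finset.univ : Finset ι)) (f := fun k => √(D k))
    refine e.trans_eq ?_
    congr 1
    exact Finset.sum_congr rfl fun k _ => Real.sq_sqrt (dualSq_nonneg _)
  exact le_of_le_sqrt_mul hX0 hC h4 h5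

end WolffDual

end

theorem pair_mul_eq_sum (φ : ℂ⟦X⟧) (g q : ℂ[X]) {N : ℕ} (hN : q.natDegree < N) :
    pair (φ * g) q = ∑ j ∈ Finset.range N, coeff j φ * (transMul g q).coeff j := by
  rw [mul_comm, ← pair_transMul, pair_eq_sum _ _ (support_subset_range
    ((natDegree_transMul_le _ _).trans_lt hN))]

theorem MultBound.norm_pair_mul_le {φ : ℂ⟦X⟧} {M : ℝ} (hM : 0 ≤ M) (hφ : MultBound φ M)
    (g q : ℂ[X]) : ‖pair (φ * g) q‖ ≤ M * (√(dirSq g) * √(dualSq q)) := by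
  rw [← pair_transMul]
  refine (norm_pair_coe_le g _).trans ?_
  have h := Real.sqrt_le_sqrt (hφ q)
  rw [Real.sqrt_mul (sq_nonneg M), Real.sqrt_sq hM] at h
  calc _ ≤ √(dirSq g) * (M * √(dualSq q)) := by gcongr
    _ = _ := by ring

theorem multBound_of_norm_pair_mul_le {φ : ℂ⟦X⟧} {M : ℝ}
    (h : ∀ g q : ℂ[X], ‖pair (φ * g) q‖ ≤ M * (√(dirSq g) * √(dualSq q))) : MultBound φ M := by
  intro q
  have h1 := h (dualNormer (transMul φ q)) q
  rw [← pair_transMul, pair_dualNormer, dirSq_dualNormer, norm_real,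
    Real.norm_of_nonneg (dualSq_nonneg _)] at h1
  set X := dualSq (transMul φ q)
  have hX : 0 ≤ X := dualSq_nonneg _
  have h2 : √X * √X = X := Real.mul_self_sqrt hX
  have h3 : √(dualSq q) * √(dualSq q) = dualSq q := Real.mul_self_sqrt (dualSq_nonneg q)
  rcases (Real.sqrt_nonneg X).eq_or_lt with h0 | h0
  · rw [← h2, ← h0, zero_mul]
    exact mul_nonneg (sq_nonneg _) (dualSq_nonneg _)
  · have h4 : √X ≤ M * √(dualSq q) := le_of_mul_le_mul_right (by linarith) h0
    calc X = √X * √X := h2.symm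
      _ ≤ (M * √(dualSq q)) * (M * √(dualSq q)) := mul_self_le_mul_self h0.le h4
      _ = M ^ 2 * (√(dualSq q) * √(dualSq q)) := by ring
      _ = _ := by rw [h3]

theorem support_eq_of_norm_coeff_eq {p q : ℂ[X]} (h : ∀ i, ‖p.coeff i‖ = ‖q.coeff i‖) :
    p.support = q.support := by
  ext i
  rw [Polynomial.mem_support_iff, Polynomial.mem_support_iff, ← norm_ne_zero_iff, h,
    norm_ne_zero_iff]

theorem dirSq_congr {p q : ℂ[X]} (h : ∀ i, ‖p.coeff i‖ = ‖q.coeff i‖) : dirSq p = dirSq q := by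
  simp only [dirSq, support_eq_of_norm_coeff_eq h, h]

theorem dualSq_congr {p q : ℂ[X]} (h : ∀ i, ‖p.coeff i‖ = ‖q.coeff i‖) :
    dualSq p = dualSq q := by
  simp only [dualSq, support_eq_of_norm_coeff_eq h, h]

theorem pair_rescale_mul {ζ : ℂ} (hζ : ‖ζ‖ = 1) (φ : ℂ⟦X⟧) (g q : ℂ[X]) :
    pair (PowerSeries.rescale ζ φ * g) q =
      pair (φ * (g.comp (Polynomial.C ζ⁻¹ * Polynomial.X) : ℂ[X]))
        (q.comp (Polynomial.C ζ * Polynomial.X)) := by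
  have hζ0 : ζ ≠ 0 := norm_ne_zero_iff.1 (by rw [hζ]; exact one_ne_zero)
  have h1 : (g : ℂ⟦X⟧) =
      PowerSeries.rescale ζ (g.comp (Polynomial.C ζ⁻¹ * Polynomial.X) : ℂ[X]) := by
    ext i
    rw [PowerSeries.coeff_rescale, Polynomial.coeff_coe, Polynomial.coeff_coe,
      Polynomial.comp_C_mul_X_coeff, mul_left_comm, ← mul_pow, mul_inv_cancel₀ hζ0, one_pow, mul_one]
  have h2 : ∀ i, ‖(q.comp (Polynomial.C ζ * Polynomial.X)).coeff i‖ = ‖q.coeff i‖ := fun i => by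
    rw [Polynomial.comp_C_mul_X_coeff, norm_mul, norm_pow, hζ, one_pow, mul_one]
  rw [h1, ← map_mul, pair_eq_sum _ q subset_rfl, pair_eq_sum _ _ subset_rfl,
    support_eq_of_norm_coeff_eq h2]
  refine Finset.sum_congr rfl fun i _ => ?_
  rw [PowerSeries.coeff_rescale, Polynomial.comp_C_mul_X_coeff]
  ring

theorem MultBound.rescale {φ : ℂ⟦X⟧} {M : ℝ} (hM : 0 ≤ M) (hφ : MultBound φ M) {w : ℂ}
    (hw : ‖w‖ ≤ 1) : MultBound (PowerSeries.rescale w φ) M := by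
  refine multBound_of_norm_pair_mul_le fun g q => ?_
  have hf : ∀ ζ : ℂ, pair (PowerSeries.rescale ζ φ * g) q =
      ∑ j ∈ Finset.range (q.natDegree + 1), ζ ^ j * coeff j φ * (transMul g q).coeff j := fun ζ => by
    rw [pair_mul_eq_sum _ _ _ (Nat.lt_succ_self _)]
    simp only [PowerSeries.coeff_rescale]
  have hd : Differentiable ℂ fun ζ : ℂ => pair (PowerSeries.rescale ζ φ * g) q := by
    simp only [hf]
    fun_prop
  refine Complex.norm_le_of_forall_mem_frontier_norm_le (f := fun ζ : ℂ =>
    pair (PowerSeries.rescale ζ φ * g) q) isBounded_ball hd.diffContOnCl (fun ζ hζ => ?_)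
      (U := ball 0 1) (by rw [closure_ball _ one_ne_zero]; simpa using hw)
  rw [frontier_ball _ one_ne_zero, mem_sphere_zero_iff_norm] at hζ
  simp only [pair_rescale_mul hζ]
  refine (hφ.norm_pair_mul_le hM _ _).trans_eq ?_
  rw [dirSq_congr (q := g) fun i => by rw [Polynomial.comp_C_mul_X_coeff, norm_mul, norm_pow,
      norm_inv, hζ, inv_one, one_pow, mul_one],
    dualSq_congr (q := q) fun i => by rw [Polynomial.comp_C_mul_X_coeff, norm_mul, norm_pow, hζ,
      one_pow, mul_one]]

theorem multBound_X_pow (j : ℕ) : MultBound (PowerSeries.X ^ j) √((j : ℝ) + 1) := by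
  intro q
  set N := q.natDegree + 1
  rw [Real.sq_sqrt (by positivity), dualSq_eq_sum q (support_subset_range (N := j + N) (by omega)),
    dualSq_eq_sum _ (support_subset_range (N := N)
      ((natDegree_transMul_le _ _).trans_lt (Nat.lt_succ_self _))), Finset.sum_range_add _ j N]
  refine le_trans ?_ (mul_le_mul_of_nonneg_left (le_add_of_nonneg_left
    (Finset.sum_nonneg fun i _ => by positivity)) (by positivity))
  rw [Finset.mul_sum]
  refine Finset.sum_le_sum fun i _ => ?_
  rw [coeff_transMul_X_pow, ← mul_div_assoc, div_le_div_iff₀ (by positivity) (by positivity)]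
  have h1 : (0 : ℝ) ≤ ‖q.coeff (j + i)‖ ^ 2 := by positivity
  have h2 : ((j + i : ℕ) : ℝ) + 1 ≤ ((j : ℝ) + 1) * ((i : ℝ) + 1) := by
    push_cast
    nlinarith [mul_nonneg (Nat.cast_nonneg (α := ℝ) i) (Nat.cast_nonneg (α := ℝ) j)]
  nlinarith

theorem MultBound.trunc {φ : ℂ⟦X⟧} {M δ : ℝ} (hM : 0 ≤ M) (hφ : MultBound φ M) {N : ℕ}
    (hδ : ∀ L, ∑ j ∈ Finset.range L, ‖coeff (N + j) φ‖ * √(((N + j : ℕ) : ℝ) + 1) ≤ δ) :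
    MultBound (PowerSeries.trunc N φ : ℂ[X]) (M + δ) := by
  refine multBound_of_norm_pair_mul_le fun g q => ?_
  set L := q.natDegree + 1 with hL
  have h1 := pair_mul_eq_sum φ g q (N := N + L) (by omega)
  have h2 := pair_mul_eq_sum (PowerSeries.trunc N φ : ℂ[X]) g q (N := N + L) (by omega)
  rw [Finset.sum_range_add] at h1 h2
  have h3 : ∑ j ∈ Finset.range L, coeff (N + j) ((PowerSeries.trunc N φ : ℂ[X]) : ℂ⟦X⟧) *
      (transMul g q).coeff (N + j) = 0 := Finset.sum_eq_zero fun j _ => by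
    rw [Polynomial.coeff_coe, PowerSeries.coeff_trunc, if_neg (by omega), zero_mul]
  have h4 : ∑ j ∈ Finset.range N, coeff j ((PowerSeries.trunc N φ : ℂ[X]) : ℂ⟦X⟧) *
      (transMul g q).coeff j = ∑ j ∈ Finset.range N, coeff j φ * (transMul g q).coeff j :=
    Finset.sum_congr rfl fun j hj => by
      rw [Polynomial.coeff_coe, PowerSeries.coeff_trunc, if_pos (Finset.mem_range.1 hj)]
  rw [h3, h4, add_zero] at h2
  rw [← h2] at h1
  rw [eq_sub_of_add_eq h1.symm, add_mul]
  refine (norm_sub_le _ _).trans (add_le_add (hφ.norm_pair_mul_le hM g q) ?_)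
  refine (norm_sum_le _ _).trans (le_trans ?_ (mul_le_mul_of_nonneg_right (hδ L) (by positivity)))
  rw [Finset.sum_mul]
  refine Finset.sum_le_sum fun j _ => ?_
  rw [norm_mul, mul_assoc, coeff_transMul, mul_comm (g : ℂ⟦X⟧)]
  gcongr
  exact (multBound_X_pow _).norm_pair_mul_le (Real.sqrt_nonneg _) g q

theorem MultBound.norm_coeff_le {φ : ℂ⟦X⟧} {M : ℝ} (hM : 0 ≤ M) (hφ : MultBound φ M) (i : ℕ) :
    ‖coeff i φ‖ ≤ M := by
  have h := hφ.norm_pair_mul_le hM 1 (Polynomial.X ^ i)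
  have h1 : dirSq 1 = 1 := by
    rw [dirSq_eq_sum (s := Finset.range 1) 1 (support_subset_range (by simp))]
    simp
  have h2 : dualSq (Polynomial.X ^ i) ≤ 1 := by
    rw [dualSq_eq_sum (s := {i}) _ ((Polynomial.support_X_pow i).subset)]
    simp only [Finset.sum_singleton, Polynomial.coeff_X_pow_self, norm_one, one_pow]
    exact div_le_one_of_le₀ (by simp) (by positivity)
  rw [h1, Polynomial.coe_one, mul_one, Real.sqrt_one, one_mul] at h
  rw [← Polynomial.monomial_one_right_eq_X_pow, pair_monomial, mul_one,
    Polynomial.monomial_one_right_eq_X_pow] at h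
  exact h.trans (mul_le_of_le_one_right hM (Real.sqrt_le_one.2 h2))

/-- The sum of a power series at a point. -/
noncomputable def seriesEval (φ : ℂ⟦X⟧) (z : ℂ) : ℂ := ∑' j, coeff j φ * z ^ j

theorem transMul_trunc (χ : ℂ⟦X⟧) {q : ℂ[X]} {N : ℕ} (hN : q.natDegree < N) :
    transMul (PowerSeries.trunc N χ : ℂ[X]) q = transMul χ q := by
  ext m
  rw [coeff_transMul_eq_sum _ _ _ hN, coeff_transMul_eq_sum _ _ _ hN]
  refine Finset.sum_congr rfl fun j hj => ?_
  rw [Polynomial.coeff_coe, PowerSeries.coeff_trunc, if_pos (Finset.mem_range.1 hj)]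

theorem transMul_pow_three (χ : ℂ⟦X⟧) (q : ℂ[X]) :
    transMul (χ ^ 3) q = transMul χ (transMul χ (transMul χ q)) := by
  rw [← transMul_mul, ← transMul_mul]; congr 2; ring

theorem transMul_trunc_pow_three (χ : ℂ⟦X⟧) {q : ℂ[X]} {N : ℕ} (hN : q.natDegree < N) :
    transMul ((PowerSeries.trunc N χ : ℂ[X]) ^ 3 : ℂ⟦X⟧) q = transMul (χ ^ 3) q := by
  have h1 := (natDegree_transMul_le χ q).trans_lt hN
  have h2 := (natDegree_transMul_le χ (transMul χ q)).trans_lt h1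
  rw [transMul_pow_three, transMul_pow_three, transMul_trunc χ hN, transMul_trunc χ h1,
    transMul_trunc χ h2]

theorem summable_succ_mul_pow {r : ℝ} (h0 : 0 ≤ r) (h1 : r < 1) :
    Summable fun j : ℕ => ((j : ℝ) + 1) * r ^ j := by
  have hr : ‖r‖ < 1 := by rwa [Real.norm_of_nonneg h0]
  have := (summable_pow_mul_geometric_of_norm_lt_one 1 hr).add
    (summable_pow_mul_geometric_of_norm_lt_one 0 hr)
  refine this.congr fun j => ?_
  simp; ring

/-- The tail of the series `∑ (j + 1) r ^ j`. -/
noncomputable def geomTail (r : ℝ) (N : ℕ) : ℝ :=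
  ∑' j : ℕ, (((j + N : ℕ) : ℝ) + 1) * r ^ (j + N)

theorem tendsto_geomTail (r : ℝ) :
    Filter.Tendsto (geomTail r) Filter.atTop (nhds 0) :=
  tendsto_sum_nat_add fun j : ℕ => ((j : ℝ) + 1) * r ^ j

theorem sum_coeff_rescale_le {φ : ℂ⟦X⟧} (hφ : ∀ i, ‖coeff i φ‖ ≤ 1) {r : ℝ} (h0 : 0 ≤ r)
    (h1 : r < 1) (N L : ℕ) :
    ∑ j ∈ Finset.range L, ‖coeff (N + j) (PowerSeries.rescale (r : ℂ) φ)‖ *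
      √(((N + j : ℕ) : ℝ) + 1) ≤ geomTail r N := by
  have hs := (summable_nat_add_iff N).2 (summable_succ_mul_pow h0 h1)
  refine le_trans (Finset.sum_le_sum fun j _ => ?_) (hs.sum_le_tsum (Finset.range L)
    fun j _ => by positivity)
  rw [PowerSeries.coeff_rescale, norm_mul, norm_pow, Complex.norm_real, Real.norm_of_nonneg h0,
    add_comm N j]
  have h2 : √(((j + N : ℕ) : ℝ) + 1) ≤ ((j + N : ℕ) : ℝ) + 1 := by
    rw [Real.sqrt_le_left (by positivity)]
    nlinarith [(Nat.cast_nonneg (j + N) : (0 : ℝ) ≤ ((j + N : ℕ) : ℝ))]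
  calc _ ≤ r ^ (j + N) * 1 * (((j + N : ℕ) : ℝ) + 1) := by
        gcongr
        exact hφ _
    _ = _ := by ring

theorem summable_seriesEval {φ : ℂ⟦X⟧} {M : ℝ} (hφ : ∀ i, ‖coeff i φ‖ ≤ M) {z : ℂ}
    (hz : ‖z‖ < 1) : Summable fun j => ‖coeff j φ * z ^ j‖ := by
  refine Summable.of_nonneg_of_le (fun _ => norm_nonneg _) (fun j => ?_)
    ((summable_geometric_of_lt_one (norm_nonneg z) hz).mul_left M)
  rw [norm_mul, norm_pow]
  gcongr
  exact hφ j

theorem norm_seriesEval_sub_le {φ : ℂ⟦X⟧} (hφ : ∀ i, ‖coeff i φ‖ ≤ 1) {r : ℝ} (h0 : 0 ≤ r)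
    (h1 : r < 1) (N : ℕ) {z : ℂ} (hz : ‖z‖ ≤ 1) :
    ‖seriesEval φ (r * z) - (PowerSeries.trunc N (PowerSeries.rescale (r : ℂ) φ)).eval z‖ ≤
      geomTail r N := by
  have hrz : ‖(r : ℂ) * z‖ ≤ r := by
    rw [norm_mul, Complex.norm_real, Real.norm_of_nonneg h0]
    exact mul_le_of_le_one_right h0 hz
  have hs := summable_seriesEval hφ (hrz.trans_lt h1)
  have he : (PowerSeries.trunc N (PowerSeries.rescale (r : ℂ) φ)).eval z =
      ∑ j ∈ Finset.range N, coeff j φ * ((r : ℂ) * z) ^ j := by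
    rw [Polynomial.eval, PowerSeries.eval₂_trunc_eq_sum_range]
    refine Finset.sum_congr rfl fun j _ => ?_
    rw [PowerSeries.coeff_rescale, mul_pow, RingHom.id_apply]
    ring
  rw [he, seriesEval, ← hs.of_norm.sum_add_tsum_nat_add N, add_sub_cancel_left]
  have hs' := (summable_nat_add_iff N).2 (summable_succ_mul_pow h0 h1)
  refine tsum_of_norm_bounded hs'.hasSum fun j => ?_
  rw [norm_mul, norm_pow]
  calc _ ≤ 1 * r ^ (j + N) := by
        gcongr
        exact hφ _
    _ ≤ _ := by
        gcongr
        linarith [(Nat.cast_nonneg (j + N) : (0 : ℝ) ≤ ((j + N : ℕ) : ℝ))]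

theorem dualSq_transMul_smul (c : ℂ) (φ : ℂ⟦X⟧) (q : ℂ[X]) :
    dualSq (transMul (c • φ) q) = ‖c‖ ^ 2 * dualSq (transMul φ q) := by
  rw [transMul_smul, dualSq_smul]

theorem MultBound.smul {φ : ℂ⟦X⟧} {M : ℝ} (hφ : MultBound φ M) (c : ℂ) :
    MultBound (c • φ) (‖c‖ * M) := fun q => by
  rw [dualSq_transMul_smul, mul_pow, mul_assoc]
  exact mul_le_mul_of_nonneg_left (hφ q) (by positivity)

theorem MultBound.mono {φ : ℂ⟦X⟧} {M M' : ℝ} (hM : 0 ≤ M) (h : M ≤ M') (hφ : MultBound φ M) :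
    MultBound φ M' := fun q => (hφ q).trans (by gcongr; exact dualSq_nonneg _)

section

theorem sumSq_option_le {ι : Type*} [Fintype ι] {h η δ : ℝ} {x y : ι → ℝ} {a : ℝ}
    (hδ : δ = η / (Fintype.card ι + 1)) (hh : 0 ≤ h) (hy : ∀ k, 0 ≤ y k)
    (h1 : h ≤ a + δ) (h2 : a ^ 2 ≤ ∑ k, y k ^ 2) (h3 : ∀ k, y k ≤ x k + δ) :
    (1 / 2 * h) ^ 2 ≤ η ^ 2 + ∑ k, x k ^ 2 := by
  have h4 : ∑ k, y k ^ 2 ≤ ∑ k, (2 * x k ^ 2 + 2 * δ ^ 2) :=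
    Finset.sum_le_sum fun k _ => by nlinarith [h3 k, hy k, sq_nonneg (x k - δ)]
  rw [Finset.sum_add_distrib, ← Finset.mul_sum, Finset.sum_const, Finset.card_univ,
    nsmul_eq_mul] at h4
  have h5 : h ^ 2 ≤ 2 * a ^ 2 + 2 * δ ^ 2 := by nlinarith [sq_nonneg (a - δ)]
  set n : ℝ := (Fintype.card ι : ℝ) with hn
  have hn0 : 0 ≤ n := Nat.cast_nonneg _
  have h6 : (n + 1) * δ ^ 2 ≤ η ^ 2 := by
    have : η = (n + 1) * δ := by rw [hδ]; field_simp
    rw [this, mul_pow]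
    have : n + 1 ≤ (n + 1) ^ 2 := by nlinarith
    gcongr
  nlinarith

variable {ι : Type*} [Fintype ι] {φ : ι → ℂ⟦X⟧} {ψ : ℂ⟦X⟧}

theorem dualSq_transMul_rescale_pow_three_le (hφ : ∀ k, MultBound (φ k) (1 / 2))
    (hψ : MultBound ψ (1 / 2))
    (hb : ∀ z : ℂ, ‖z‖ < 1 → ‖seriesEval ψ z‖ ^ 2 ≤ ∑ k, ‖seriesEval (φ k) z‖ ^ 2)
    {r η : ℝ} (h0 : 0 ≤ r) (h1 : r < 1) (hη : 0 < η) (hη' : η ≤ 1 / 2) (q : ℂ[X]) :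
    dualSq (transMul (PowerSeries.rescale (r : ℂ) ψ ^ 3) q) ≤
      64 * (wolffConst (Fintype.card ι + 1) * (Fintype.card ι + 1)) *
        (η ^ 2 * dualSq q +
          ∑ k, dualSq (transMul (PowerSeries.rescale (r : ℂ) (φ k)) q)) := by
  set δ : ℝ := η / (Fintype.card ι + 1) with hδ
  have hδ0 : 0 < δ := by positivity
  have hδη : δ ≤ η := div_le_self hη.le (by linarith [(Nat.cast_nonneg (Fintype.card ι) : (0:ℝ) ≤ _)])
  obtain ⟨N, hN, hqN⟩ := (((tendsto_geomTail r).eventually (ge_mem_nhds hδ0)).and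
    (Filter.eventually_gt_atTop q.natDegree)).exists
  have hr : ‖(r : ℂ)‖ ≤ 1 := by rw [Complex.norm_real, Real.norm_of_nonneg h0]; exact h1.le
  have hcoef : ∀ {χ : ℂ⟦X⟧}, MultBound χ (1 / 2) → ∀ i, ‖coeff i χ‖ ≤ 1 := fun h i =>
    (h.norm_coeff_le (by norm_num) i).trans (by norm_num)
  have hT : ∀ {χ : ℂ⟦X⟧}, MultBound χ (1 / 2) →
      MultBound (PowerSeries.trunc N (PowerSeries.rescale (r : ℂ) χ) : ℂ[X]) 1 := fun h =>
    (MultBound.trunc (by norm_num) (h.rescale (by norm_num) hr) fun L =>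
      (sum_coeff_rescale_le (hcoef h) h0 h1 N L).trans hN).mono (by positivity) (by linarith)
  have hE : ∀ {χ : ℂ⟦X⟧}, MultBound χ (1 / 2) → ∀ {z : ℂ}, ‖z‖ ≤ 1 →
      ‖seriesEval χ (r * z) - (PowerSeries.trunc N (PowerSeries.rescale (r : ℂ) χ)).eval z‖ ≤ δ :=
    fun h _ hz => (norm_seriesEval_sub_le (hcoef h) h0 h1 N hz).trans hN
  let f : Option ι → ℂ[X] := fun o => o.elim (Polynomial.C (η : ℂ))
    fun k => PowerSeries.trunc N (PowerSeries.rescale (r : ℂ) (φ k))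
  let P : ℂ[X] := PowerSeries.trunc N (PowerSeries.rescale (r : ℂ) ψ)
  let H : ℂ[X] := Polynomial.C (1 / 2) * P
  have hC : ∀ c : ℂ, ∀ p : ℂ[X], ((Polynomial.C c * p : ℂ[X]) : ℂ⟦X⟧) = c • (p : ℂ⟦X⟧) :=
    fun c p => by rw [← Polynomial.smul_eq_C_mul, Polynomial.coe_smul]
  have hη1 : ((Polynomial.C (η : ℂ) : ℂ[X]) : ℂ⟦X⟧) = (η : ℂ) • 1 := by
    have := hC η 1
    rwa [mul_one, Polynomial.coe_one] at this
  have hone : MultBound (1 : ℂ⟦X⟧) 1 := fun q => by rw [transMul_one]; simp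
  have hηn : ‖(η : ℂ)‖ = η := by rw [Complex.norm_real, Real.norm_of_nonneg hη.le]
  have hf : ∀ o, MultBound (f o) 1 := by
    rintro (_ | k)
    · change MultBound ((Polynomial.C (η : ℂ) : ℂ[X]) : ℂ⟦X⟧) 1
      rw [hη1]
      exact (hone.smul η).mono (by positivity) (by rw [hηn]; linarith)
    · exact hT (hφ k)
  have hH1 : MultBound H 1 := by
    change MultBound ((Polynomial.C (1 / 2) * P : ℂ[X]) : ℂ⟦X⟧) 1
    rw [hC]
    exact ((hT hψ).smul (1 / 2)).mono (by positivity) (by norm_num)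
  have hsum : ∀ z, ‖sumSq f z‖ = η ^ 2 + ∑ k, ‖(f (some k)).eval z‖ ^ 2 := fun z => by
    rw [norm_sumSq, Fintype.sum_option]
    congr 1
    change ‖(Polynomial.C (η : ℂ)).eval z‖ ^ 2 = _
    rw [Polynomial.eval_C, hηn]
  have hS : ∀ z ∈ closedBall (0 : ℂ) 1, sumSq f z ≠ 0 := fun z _ => by
    rw [← norm_pos_iff, hsum]
    positivity
  have hH : ∀ z ∈ closedBall (0 : ℂ) 1, ‖H.eval z‖ ^ 2 ≤ ‖sumSq f z‖ := fun z hz => by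
    have hz1 : ‖z‖ ≤ 1 := mem_closedBall_zero_iff.1 hz
    have hrz : ‖(r : ℂ) * z‖ < 1 := by
      rw [norm_mul, Complex.norm_real, Real.norm_of_nonneg h0]
      exact (mul_le_of_le_one_right h0 hz1).trans_lt h1
    rw [hsum, Polynomial.eval_mul, Polynomial.eval_C, norm_mul]
    have : ‖(1 / 2 : ℂ)‖ = 1 / 2 := by norm_num
    rw [this]
    refine sumSq_option_le (y := fun k => ‖seriesEval (φ k) (r * z)‖) hδ (norm_nonneg _)
      (fun k => norm_nonneg _) (a := ‖seriesEval ψ (r * z)‖) ?_ (hb _ hrz) fun k => ?_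
    · have := norm_sub_norm_le (P.eval z) (seriesEval ψ (r * z))
      rw [norm_sub_rev] at this
      linarith [hE hψ hz1]
    · have h2 := norm_sub_norm_le (seriesEval (φ k) (r * z)) ((f (some k)).eval z)
      exact sub_le_iff_le_add'.1 (h2.trans (hE (hφ k) hz1))
  have key := dualSq_transMul_pow_three_le hf hH1 hS hH q
  have hHq : dualSq (transMul ((H : ℂ⟦X⟧) ^ 3) q) =
      1 / 64 * dualSq (transMul (PowerSeries.rescale (r : ℂ) ψ ^ 3) q) := by
    rw [← transMul_trunc_pow_three (PowerSeries.rescale (r : ℂ) ψ) hqN, hC, smul_pow, dualSq_transMul_smul]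
    have : ‖((1 / 2 : ℂ)) ^ 3‖ ^ 2 = 1 / 64 := by norm_num
    rw [this]
  have hfη : dualSq (transMul (f none) q) = η ^ 2 * dualSq q := by
    change dualSq (transMul ((Polynomial.C (η : ℂ) : ℂ[X]) : ℂ⟦X⟧) q) = _
    rw [hη1, dualSq_transMul_smul, transMul_one, hηn]
  have hfk : ∀ k, dualSq (transMul (f (some k)) q) =
      dualSq (transMul (PowerSeries.rescale (r : ℂ) (φ k)) q) := fun k => by
    rw [← transMul_trunc (PowerSeries.rescale (r : ℂ) (φ k)) hqN]
    rfl
  rw [hHq, Fintype.sum_option, hfη, Fintype.card_option] at key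
  simp only [hfk] at key
  push_cast at key
  linarith

theorem dualSq_eq_sum_transMul (φ : ℂ⟦X⟧) {q : ℂ[X]} {N : ℕ} (hN : q.natDegree < N) :
    dualSq (transMul φ q) = ∑ i ∈ Finset.range N,
      ‖∑ j ∈ Finset.range N, coeff j φ * q.coeff (j + i)‖ ^ 2 / ((i : ℝ) + 1) := by
  rw [dualSq_eq_sum _ (support_subset_range ((natDegree_transMul_le φ q).trans_lt hN))]
  refine Finset.sum_congr rfl fun i _ => ?_
  rw [coeff_transMul_eq_sum φ q i hN]

theorem tendsto_dualSq_transMul_rescale (φ : ℂ⟦X⟧) (q : ℂ[X]) :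
    Filter.Tendsto (fun r : ℝ => dualSq (transMul (PowerSeries.rescale (r : ℂ) φ) q))
      (nhdsWithin 1 (Set.Iio 1)) (nhds (dualSq (transMul φ q))) := by
  have hc : Continuous fun r : ℝ => dualSq (transMul (PowerSeries.rescale (r : ℂ) φ) q) := by
    simp only [dualSq_eq_sum_transMul _ (Nat.lt_succ_self q.natDegree), PowerSeries.coeff_rescale]
    fun_prop (disch := intros; positivity)
  have := (hc.tendsto 1).mono_left (nhdsWithin_le_nhds (s := Set.Iio 1))
  simpa using this

theorem dualSq_transMul_pow_three_le_of_norm_le (hφ : ∀ k, MultBound (φ k) (1 / 2))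
    (hψ : MultBound ψ (1 / 2))
    (hb : ∀ z : ℂ, ‖z‖ < 1 → ‖seriesEval ψ z‖ ^ 2 ≤ ∑ k, ‖seriesEval (φ k) z‖ ^ 2) (q : ℂ[X]) :
    dualSq (transMul (ψ ^ 3) q) ≤
      64 * (wolffConst (Fintype.card ι + 1) * (Fintype.card ι + 1)) *
        ∑ k, dualSq (transMul (φ k) q) := by
  have hr : ∀ r : ℝ, 0 ≤ r → r < 1 →
      dualSq (transMul (PowerSeries.rescale (r : ℂ) (ψ ^ 3)) q) ≤
      64 * (wolffConst (Fintype.card ι + 1) * (Fintype.card ι + 1)) *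
        ∑ k, dualSq (transMul (PowerSeries.rescale (r : ℂ) (φ k)) q) := fun r h0 h1 => by
    rw [map_pow]
    have ht : Filter.Tendsto (fun η : ℝ =>
        64 * (wolffConst (Fintype.card ι + 1) * (Fintype.card ι + 1)) *
        (η ^ 2 * dualSq q + ∑ k, dualSq (transMul (PowerSeries.rescale (r : ℂ) (φ k)) q)))
        (nhdsWithin 0 (Set.Ioi 0))
        (nhds (64 * (wolffConst (Fintype.card ι + 1) * (Fintype.card ι + 1)) *
        (0 ^ 2 * dualSq q +
          ∑ k, dualSq (transMul (PowerSeries.rescale (r : ℂ) (φ k)) q)))) :=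
      (Continuous.tendsto (by fun_prop) 0).mono_left nhdsWithin_le_nhds
    have := ge_of_tendsto ht (b := dualSq (transMul (PowerSeries.rescale (r : ℂ) ψ ^ 3) q)) <| by
      filter_upwards [Ioc_mem_nhdsGT (show (0 : ℝ) < 1 / 2 by norm_num)] with η hη
      exact dualSq_transMul_rescale_pow_three_le hφ hψ hb h0 h1 hη.1 hη.2 q
    simpa using this
  refine le_of_tendsto_of_tendsto (tendsto_dualSq_transMul_rescale (ψ ^ 3) q)
    ((tendsto_finsetSum Finset.univ fun k _ =>
      tendsto_dualSq_transMul_rescale (φ k) q).const_mul _) ?_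
  filter_upwards [Ico_mem_nhdsLT (show (0 : ℝ) < 1 by norm_num)] with r h
  exact hr r h.1 h.2

end

/-- The Taylor series at the origin. -/
noncomputable def taylor (f : ℂ → ℂ) : ℂ⟦X⟧ := PowerSeries.mk (dirCoeff f)

theorem hasSum_taylor {f : ℂ → ℂ} (hf : DifferentiableOn ℂ f (ball 0 1)) {z : ℂ}
    (hz : z ∈ ball (0 : ℂ) 1) : HasSum (fun j => coeff j (taylor f) * z ^ j) (f z) := by
  have := Complex.hasSum_taylorSeries_on_ball hf hz
  have h : (fun j => coeff j (taylor f) * z ^ j) =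
      fun n : ℕ => ((n.factorial : ℂ))⁻¹ • (z - 0) ^ n • iteratedDeriv n f 0 := funext fun j => by
    rw [taylor, PowerSeries.coeff_mk, dirCoeff, sub_zero, smul_eq_mul, smul_eq_mul]
    ring
  rw [h]
  exact this

theorem seriesEval_taylor {f : ℂ → ℂ} (hf : DifferentiableOn ℂ f (ball 0 1)) {z : ℂ}
    (hz : z ∈ ball (0 : ℂ) 1) : seriesEval (taylor f) z = f z := (hasSum_taylor hf hz).tsum_eq

theorem taylor_eq_of_hasSum {f : ℂ → ℂ} (hf : DifferentiableOn ℂ f (ball 0 1)) {G : ℂ⟦X⟧}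
    (hG : ∀ z ∈ ball (0 : ℂ) 1, HasSum (fun j => coeff j G * z ^ j) (f z)) : taylor f = G := by
  have h1 : HasFPowerSeriesAt f (FormalMultilinearSeries.ofScalars ℂ (dirCoeff f)) 0 :=
    (hf.analyticAt (ball_mem_nhds 0 one_pos)).hasFPowerSeriesAt
  have h2 : HasFPowerSeriesAt f (FormalMultilinearSeries.ofScalars ℂ fun n => coeff n G) 0 := by
    rw [hasFPowerSeriesAt_iff]
    filter_upwards [ball_mem_nhds (0 : ℂ) one_pos] with z hz
    simpa [FormalMultilinearSeries.coeff_ofScalars, mul_comm] using hG z hz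
  ext n
  have := congr_arg (FormalMultilinearSeries.coeff · n) (h1.eq_formalMultilinearSeries h2)
  simpa [FormalMultilinearSeries.coeff_ofScalars, taylor] using this

theorem summable_norm_mul {A B : ℂ⟦X⟧} {z : ℂ} (hA : Summable fun j => ‖coeff j A * z ^ j‖)
    (hB : Summable fun j => ‖coeff j B * z ^ j‖) :
    Summable (fun j => ‖coeff j (A * B) * z ^ j‖) ∧
      seriesEval (A * B) z = seriesEval A z * seriesEval B z := by
  have h : ∀ n, ∑ kl ∈ Finset.HasAntidiagonal.antidiagonal n, coeff kl.1 A * z ^ kl.1 * (coeff kl.2 B * z ^ kl.2) =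
      coeff n (A * B) * z ^ n := fun n => by
    rw [PowerSeries.coeff_mul, Finset.sum_mul]
    refine Finset.sum_congr rfl fun kl hkl => ?_
    rw [← Finset.HasAntidiagonal.mem_antidiagonal.1 hkl]
    ring
  have h1 := summable_norm_sum_mul_antidiagonal_of_summable_norm hA hB
  have h2 := tsum_mul_tsum_eq_tsum_sum_antidiagonal_of_summable_norm hA hB
  simp only [h] at h1 h2
  exact ⟨h1, h2.symm⟩

theorem taylor_mul {f g : ℂ → ℂ} (hf : DifferentiableOn ℂ f (ball 0 1))
    (hg : DifferentiableOn ℂ g (ball 0 1)) :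
    taylor (fun z => f z * g z) = taylor f * taylor g :=
  taylor_eq_of_hasSum (hf.mul hg) fun z hz => by
    obtain ⟨h1, h2⟩ := summable_norm_mul (hasSum_taylor hf hz).summable.norm
      (hasSum_taylor hg hz).summable.norm
    change HasSum _ (f z * g z)
    rw [← seriesEval_taylor hf hz, ← seriesEval_taylor hg hz, ← h2]
    exact h1.of_norm.hasSum

theorem seriesEval_smul (c : ℂ) (G : ℂ⟦X⟧) (z : ℂ) :
    seriesEval (c • G) z = c * seriesEval G z := by
  simp only [seriesEval, PowerSeries.coeff_smul, smul_eq_mul, mul_assoc, tsum_mul_left]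

theorem seriesEval_sum {ι : Type*} (s : Finset ι) (G : ι → ℂ⟦X⟧) {z : ℂ}
    (hG : ∀ k ∈ s, Summable fun j => ‖coeff j (G k) * z ^ j‖) :
    seriesEval (∑ k ∈ s, G k) z = ∑ k ∈ s, seriesEval (G k) z := by
  simp only [seriesEval, map_sum, Finset.sum_mul]
  exact Summable.tsum_finsetSum fun k hk => (hG k hk).of_norm

theorem differentiableOn_seriesEval {G : ℂ⟦X⟧} {M : ℝ} (hG : ∀ i, ‖coeff i G‖ ≤ M) :
    DifferentiableOn ℂ (seriesEval G) (ball 0 1) := by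
  intro z hz
  obtain ⟨ρ, h1, h2⟩ := exists_between (mem_ball_zero_iff.1 hz)
  have h0 : 0 ≤ ρ := (norm_nonneg z).trans h1.le
  have : DifferentiableOn ℂ (seriesEval G) (ball 0 ρ) :=
    differentiableOn_tsum_of_summable_norm
      ((summable_geometric_of_lt_one h0 h2).mul_left M) (fun i => by fun_prop) isOpen_ball
      fun i w hw => by
        have hw' := mem_ball_zero_iff.1 hw
        rw [norm_mul, norm_pow]
        have hM : 0 ≤ M := (norm_nonneg _).trans (hG i)
        gcongr
        exact hG i
  exact (this.differentiableAt (isOpen_ball.mem_nhds (mem_ball_zero_iff.2 h1)))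
    |>.differentiableWithinAt

theorem taylor_seriesEval {G : ℂ⟦X⟧} {M : ℝ} (hG : ∀ i, ‖coeff i G‖ ≤ M) :
    taylor (seriesEval G) = G :=
  taylor_eq_of_hasSum (differentiableOn_seriesEval hG) fun _ hz =>
    (summable_seriesEval hG (mem_ball_zero_iff.1 hz)).of_norm.hasSum

theorem memDirichlet_seriesEval {G : ℂ⟦X⟧}
    (hG : Summable fun n : ℕ => ((n : ℝ) + 1) * ‖coeff n G‖ ^ 2) :
    MemDirichlet (seriesEval G) ∧ taylor (seriesEval G) = G := by
  have hb : ∀ i, ‖coeff i G‖ ≤ √(∑' n : ℕ, ((n : ℝ) + 1) * ‖coeff n G‖ ^ 2) := fun i => by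
    refine Real.le_sqrt_of_sq_le (le_trans ?_ (hG.le_tsum i fun j _ => by positivity))
    nlinarith [sq_nonneg ‖coeff i G‖, (Nat.cast_nonneg i : (0 : ℝ) ≤ i)]
  have h := taylor_seriesEval hb
  refine ⟨⟨differentiableOn_seriesEval hb, hG.congr fun n => ?_⟩, h⟩
  conv_lhs => rw [← h]
  rw [taylor, PowerSeries.coeff_mk]

theorem summable_of_memDirichlet {f : ℂ → ℂ} (hf : MemDirichlet f) :
    Summable fun n : ℕ => ((n : ℝ) + 1) * ‖coeff n (taylor f)‖ ^ 2 := by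
  simpa only [taylor, PowerSeries.coeff_mk] using hf.2

theorem MultBound.isMultiplier {G : ℂ⟦X⟧} {M : ℝ} (hM : 0 ≤ M) (hG : MultBound G M) :
    IsMultiplier (seriesEval G) := by
  have hc := hG.norm_coeff_le hM
  have hd := differentiableOn_seriesEval hc
  refine ⟨hd, fun f hf => ⟨hd.mul hf.1, ?_⟩⟩
  have h : ∀ n, dirCoeff (fun z => seriesEval G z * f z) n = coeff n (G * taylor f) := fun n => by
    have h1 := taylor_mul hd hf.1
    rw [taylor_seriesEval hc] at h1
    rw [← h1, taylor, PowerSeries.coeff_mk]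
  simp only [h]
  have hs := summable_of_memDirichlet hf
  refine summable_of_sum_range_le (fun n => by positivity) fun N =>
    (hG.sum_mul_le (taylor f) N).trans (mul_le_mul_of_nonneg_left
      (hs.sum_le_tsum (Finset.range (N + 1)) fun j _ => by positivity) (sq_nonneg M))

theorem pair_mul_eq_sum_coeff (φ g : ℂ⟦X⟧) (q : ℂ[X]) {N : ℕ} (hN : q.natDegree < N) :
    pair (φ * g) q = ∑ j ∈ Finset.range N, coeff j g * (transMul φ q).coeff j := by
  rw [← pair_transMul, pair_eq_sum _ _ (support_subset_range
    ((natDegree_transMul_le _ _).trans_lt hN))]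

/-- The power series in the Dirichlet space with given normalized coefficients. -/
noncomputable def weightedSeries (x : ℕ → ℂ) : ℂ⟦X⟧ :=
  PowerSeries.mk fun j => x j / (√((j : ℝ) + 1) : ℝ)

theorem weight_mul_sq (j : ℕ) (c : ℂ) :
    ((j : ℝ) + 1) * ‖c / ((√((j : ℝ) + 1) : ℝ) : ℂ)‖ ^ 2 = ‖c‖ ^ 2 := by
  have h : (0 : ℝ) < (j : ℝ) + 1 := by positivity
  rw [norm_div, Complex.norm_real, Real.norm_of_nonneg (Real.sqrt_nonneg _), div_pow,
    Real.sq_sqrt h.le]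
  field_simp

theorem summable_lp_two (x : lp (fun _ : ℕ => ℂ) 2) : Summable fun j => ‖x j‖ ^ 2 := by
  have := (memℓp_gen_iff (p := 2) (by norm_num)).1 (lp.memℓp x)
  simpa using this

/-- The functional `x ↦ pair (φ * weightedSeries x) q` on `ℓ²`. -/
noncomputable def pairFunctional (φ : ℂ⟦X⟧) (q : ℂ[X]) : lp (fun _ : ℕ => ℂ) 2 →L[ℂ] ℂ :=
  ∑ j ∈ Finset.range (q.natDegree + 1),
    ((transMul φ q).coeff j / (√((j : ℝ) + 1) : ℝ)) • lp.evalCLM ℂ (fun _ : ℕ => ℂ) 2 j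

theorem pairFunctional_apply (φ : ℂ⟦X⟧) (q : ℂ[X]) (x : lp (fun _ : ℕ => ℂ) 2) :
    pairFunctional φ q x = pair (φ * weightedSeries x) q := by
  rw [pair_mul_eq_sum_coeff φ _ q (Nat.lt_succ_self _), pairFunctional,
    _root_.sum_apply]
  refine Finset.sum_congr rfl fun j _ => ?_
  rw [_root_.smul_apply, weightedSeries, PowerSeries.coeff_mk, smul_eq_mul]
  change _ * x j = _
  ring

theorem exists_norm_pair_le_of_isMultiplier {φ : ℂ → ℂ} (hφ : IsMultiplier φ) {g : ℂ⟦X⟧}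
    (hg : Summable fun n : ℕ => ((n : ℝ) + 1) * ‖coeff n g‖ ^ 2) :
    ∃ C : ℝ, ∀ q : ℂ[X], ‖pair (taylor φ * g) q‖ ≤ C * √(dualSq q) := by
  obtain ⟨h1, h2⟩ := memDirichlet_seriesEval hg
  have hs := summable_of_memDirichlet (hφ.2 _ h1)
  rw [taylor_mul hφ.1 h1.1, h2] at hs
  refine ⟨√(∑' n : ℕ, ((n : ℝ) + 1) * ‖coeff n (taylor φ * g)‖ ^ 2), fun q =>
    (norm_pair_le _ q (Nat.lt_succ_self _)).trans ?_⟩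
  gcongr
  exact hs.sum_le_tsum _ fun j _ => by positivity

theorem IsMultiplier.exists_multBound {φ : ℂ → ℂ} (hφ : IsMultiplier φ) :
    ∃ M, 0 ≤ M ∧ MultBound (taylor φ) M := by
  have hbs : ∀ x : lp (fun _ : ℕ => ℂ) 2, ∃ C, ∀ q : {q : ℂ[X] // dualSq q ≤ 1},
      ‖pairFunctional (taylor φ) q x‖ ≤ C := fun x => by
    have hx : Summable fun n : ℕ => ((n : ℝ) + 1) * ‖coeff n (weightedSeries x)‖ ^ 2 := by
      simpa only [weightedSeries, PowerSeries.coeff_mk, weight_mul_sq] using summable_lp_two x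
    obtain ⟨C, hC⟩ := exists_norm_pair_le_of_isMultiplier hφ hx
    refine ⟨|C|, fun q => ?_⟩
    rw [pairFunctional_apply]
    calc _ ≤ C * √(dualSq q.1) := hC q.1
      _ ≤ |C| * 1 := mul_le_mul (le_abs_self C) (Real.sqrt_le_one.2 q.2) (Real.sqrt_nonneg _)
          (abs_nonneg C)
      _ = |C| := mul_one _
  obtain ⟨M, hM⟩ := banach_steinhaus hbs
  have hM0 : 0 ≤ M := (norm_nonneg _).trans (hM ⟨0, by simp [dualSq]⟩)
  refine ⟨M, hM0, multBound_of_norm_pair_mul_le fun g q => ?_⟩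
  have hmem : Memℓp (fun j => g.coeff j * (√((j : ℝ) + 1) : ℝ)) 2 :=
    (memℓp_gen_iff (p := 2) (E := fun _ : ℕ => ℂ) (by norm_num)).2 <|
      summable_of_hasFiniteSupport <| (Finset.finite_toSet g.support).subset fun j hj => by
        rw [Finset.mem_coe, Polynomial.mem_support_iff]
        intro h0
        simp [h0] at hj
  let x : lp (fun _ : ℕ => ℂ) 2 := ⟨fun j => g.coeff j * (√((j : ℝ) + 1) : ℝ), hmem⟩
  have hxj : ∀ j, x j = g.coeff j * (√((j : ℝ) + 1) : ℝ) := fun _ => rfl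
  have hpos : ∀ j : ℕ, ((√((j : ℝ) + 1) : ℝ) : ℂ) ≠ 0 := fun j =>
    Complex.ofReal_ne_zero.2 (by positivity)
  have hxg : weightedSeries x = g := by
    ext j
    rw [weightedSeries, PowerSeries.coeff_mk, hxj, mul_div_cancel_right₀ _ (hpos j),
      Polynomial.coeff_coe]
  have hxn : ‖x‖ = √(dirSq g) := by
    have h1 := lp.norm_rpow_eq_tsum (p := 2) (by norm_num) x
    have h2 : ∑' j, ‖x j‖ ^ 2 = dirSq g := by
      rw [dirSq, tsum_eq_sum (s := g.support)]
      · refine Finset.sum_congr rfl fun j _ => ?_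
        rw [hxj, ← weight_mul_sq, mul_div_cancel_right₀ _ (hpos j)]
      · intro j hj
        rw [hxj, Polynomial.notMem_support_iff.1 hj]
        simp
    have h3 : ‖x‖ ^ 2 = dirSq g := by
      rw [← h2]
      simpa using h1
    rw [← h3, Real.sqrt_sq (norm_nonneg _)]
  rcases (dualSq_nonneg q).eq_or_lt with h0 | h0
  · have := norm_pair_le (taylor φ * g) q (Nat.lt_succ_self _)
    rw [← h0] at this ⊢
    simpa using this
  have hs : (0 : ℝ) < √(dualSq q) := Real.sqrt_pos.2 h0
  set c : ℂ := (((√(dualSq q))⁻¹ : ℝ) : ℂ) with hc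
  have hcn : ‖c‖ = (√(dualSq q))⁻¹ := by
    rw [hc, Complex.norm_real, Real.norm_of_nonneg (by positivity)]
  have hq1 : dualSq (c • q) ≤ 1 := by
    rw [dualSq_smul, hcn, inv_pow, Real.sq_sqrt h0.le, inv_mul_cancel₀ h0.ne']
  have h4 := ((pairFunctional (taylor φ) (c • q)).le_opNorm x).trans
    (mul_le_mul_of_nonneg_right (hM ⟨c • q, hq1⟩) (norm_nonneg x))
  rw [pairFunctional_apply, hxg, hxn, map_smul, norm_smul, hcn, inv_mul_le_iff₀ hs] at h4
  linarith

end DirichletWolff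

open DirichletWolff

/-- Wolff's theorem for the multiplier algebra of the Dirichlet space
(finitely many generators): the pointwise bound puts `H ^ 3` in the ideal. -/
theorem wolff_dirichlet_finitely_many
    (n : ℕ) (H : ℂ → ℂ) (f : Fin n → ℂ → ℂ)
    (hH : IsMultiplier H) (hf : ∀ j, IsMultiplier (f j))
    (hb : ∀ z ∈ ball (0:ℂ) 1,
      ‖H z‖ ≤ Real.sqrt (∑ j : Fin n, ‖f j z‖ ^ 2)) :
    ∃ g : Fin n → ℂ → ℂ, (∀ j, IsMultiplier (g j)) ∧
      ∀ z ∈ ball (0:ℂ) 1, (H z) ^ 3 = ∑ j : Fin n, f j z * g j z := by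
  obtain ⟨M₀, hM₀, hHM⟩ := hH.exists_multBound
  choose M hM hfM using fun j => (hf j).exists_multBound
  set K : ℝ := M₀ + ∑ j, M j + 1 with hK
  have hMs : 0 ≤ ∑ j, M j := Finset.sum_nonneg fun j _ => hM j
  have hK0 : 0 < K := by positivity
  set c : ℂ := ((1 / (2 * K) : ℝ) : ℂ) with hc
  have hcn : ‖c‖ = 1 / (2 * K) := by
    rw [hc, Complex.norm_real, Real.norm_of_nonneg (by positivity)]
  have hc0 : c ≠ 0 := norm_pos_iff.1 (by rw [hcn]; positivity)
  have hhalf : ∀ {χ : PowerSeries ℂ} {m : ℝ}, 0 ≤ m → m ≤ K → MultBound χ m →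
      MultBound (c • χ) (1 / 2) := fun h0 h1 h =>
    (h.smul c).mono (by positivity) (by
      rw [hcn, div_mul_eq_mul_div, one_mul, div_le_div_iff₀ (by positivity) (by positivity)]
      linarith)
  have hψ := hhalf hM₀ (by linarith) hHM
  have hφ : ∀ k, MultBound (c • taylor (f k)) (1 / 2) := fun k =>
    hhalf (hM k) (by linarith [Finset.single_le_sum (fun j _ => hM j) (Finset.mem_univ k)]) (hfM k)
  set C : ℝ := 64 * (wolffConst (Fintype.card (Fin n) + 1) * (Fintype.card (Fin n) + 1)) with hC
  have hC0 : 0 ≤ C := by rw [hC, wolffConst]; positivity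
  have key : ∀ q, dualSq (transMul ((c • taylor H) ^ 3) q) ≤
      C * ∑ k, dualSq (transMul (c • taylor (f k)) q) :=
    dualSq_transMul_pow_three_le_of_norm_le hφ hψ fun z hz => by
      have hz' := mem_ball_zero_iff.2 hz
      have h1 : ‖H z‖ ^ 2 ≤ ∑ j, ‖f j z‖ ^ 2 :=
        (Real.le_sqrt (norm_nonneg _) (Finset.sum_nonneg fun _ _ => sq_nonneg _)).1 (hb z hz')
      simp only [seriesEval_smul, norm_mul, mul_pow, ← Finset.mul_sum, seriesEval_taylor hH.1 hz',
        fun k => seriesEval_taylor (hf k).1 hz']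
      gcongr
  set s : ℂ := ((√C : ℝ) : ℂ) with hs
  have hsn : ‖s‖ ^ 2 = C := by
    rw [hs, Complex.norm_real, Real.norm_of_nonneg (Real.sqrt_nonneg _), Real.sq_sqrt hC0]
  obtain ⟨G, hG, hG1⟩ := exists_factorization (fun k => s • c • taylor (f k))
    ((c • taylor H) ^ 3) fun q => by
      simpa only [dualSq_transMul_smul s, hsn, Finset.mul_sum] using key q
  have hid : taylor H ^ 3 = ∑ k, taylor (f k) * ((s / c ^ 2) • G k) := by
    have h3 : (c ^ 3) • taylor H ^ 3 = (c ^ 3) • ∑ k, taylor (f k) * ((s / c ^ 2) • G k) := by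
      rw [← smul_pow, hG, Finset.smul_sum]
      refine Finset.sum_congr rfl fun k _ => ?_
      rw [mul_smul_comm, smul_smul, smul_smul, smul_mul_assoc]
      congr 1
      field_simp
    exact smul_right_injective _ (pow_ne_zero 3 hc0) h3
  have hGb : ∀ k, MultBound ((s / c ^ 2) • G k) (‖s / c ^ 2‖ * 1) := fun k => (hG1 k).smul _
  refine ⟨fun k => seriesEval ((s / c ^ 2) • G k), fun k =>
    (hGb k).isMultiplier (by positivity), fun z hz => ?_⟩
  have hz' := mem_ball_zero_iff.1 hz
  have hHs := (hasSum_taylor hH.1 hz).summable.norm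
  have hfs := fun k => (hasSum_taylor (hf k).1 hz).summable.norm
  have hGs := fun k => summable_seriesEval ((hGb k).norm_coeff_le (by positivity)) hz'
  have h1 := summable_norm_mul hHs hHs
  have h2 := summable_norm_mul h1.1 hHs
  have h3 : seriesEval (taylor H ^ 3) z = H z ^ 3 := by
    rw [pow_succ, pow_two, h2.2, h1.2, seriesEval_taylor hH.1 hz, pow_succ, pow_two]
  rw [← h3, hid, seriesEval_sum _ _ fun k _ => (summable_norm_mul (hfs k) (hGs k)).1]
  refine Finset.sum_congr rfl fun k _ => ?_
  rw [(summable_norm_mul (hfs k) (hGs k)).2, seriesEval_taylor (hf k).1 hz]
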